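/- arXiv:1506.00922 — 4 statements merged into one kernel-verified Lean document; each statement's English description precedes it below -/
import Mathlib

section
/- For every p > N, the limit Λ_p(Ω) := lim_{q→∞} λ_q(Ω) exists, and it equals inf { ∫_Ω ‖∇u(x)‖^p dx : u smooth with compact support contained in Ω and sup_{x∈Ω} |u(x)| = 1 }. -/
open MeasureTheory Filter Topology Metric

noncomputable def lambdaQ {N : ℕ} (Ω : Set (EuclideanSpace ℝ (Fin N))) (p q : ℝ) : ℝ :=
  sInf { c : ℝ | ∃ u : EuclideanSpace ℝ (Fin N) → ℝ,
    ContDiff ℝ (⊤ : ℕ∞) u ∧ HasCompactSupport u ∧ tsupport u ⊆ Ω ∧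
    (∫ x in Ω, |u x| ^ q) ^ (1 / q) = 1 ∧
    c = ∫ x in Ω, ‖gradient u x‖ ^ p }

noncomputable def LambdaP {N : ℕ} (Ω : Set (EuclideanSpace ℝ (Fin N))) (p : ℝ) : ℝ :=
  sInf { c : ℝ | ∃ u : EuclideanSpace ℝ (Fin N) → ℝ,
    ContDiff ℝ (⊤ : ℕ∞) u ∧ HasCompactSupport u ∧ tsupport u ⊆ Ω ∧
    sSup ((fun x => |u x|) '' Ω) = 1 ∧
    c = ∫ x in Ω, ‖gradient u x‖ ^ p }

def Adm {N : ℕ} (Ω : Set (EuclideanSpace ℝ (Fin N))) (u : EuclideanSpace ℝ (Fin N) → ℝ) : Prop :=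
  ContDiff ℝ (⊤ : ℕ∞) u ∧ HasCompactSupport u ∧ tsupport u ⊆ Ω

lemma Adm.smul {N : ℕ} {Ω : Set (EuclideanSpace ℝ (Fin N))} {u : EuclideanSpace ℝ (Fin N) → ℝ}
    (h : Adm Ω u) (c : ℝ) : Adm Ω (fun x => c * u x) := by
  obtain ⟨h1, h2, h3⟩ := h
  refine ⟨contDiff_const.mul h1, h2.mul_left, ?_⟩
  exact (tsupport_mul_subset_right (f := fun _ => c) (g := u)).trans h3

lemma energy_smul {N : ℕ} {Ω : Set (EuclideanSpace ℝ (Fin N))} {u : EuclideanSpace ℝ (Fin N) → ℝ}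
    (h : Adm Ω u) {c : ℝ} (hc : 0 ≤ c) (p : ℝ) :
    ∫ x in Ω, ‖gradient (fun x => c * u x) x‖ ^ p = c ^ p * ∫ x in Ω, ‖gradient u x‖ ^ p := by
  rw [← integral_const_mul]
  congr 1
  ext x
  have hd : DifferentiableAt ℝ u x := (h.1.differentiable (by simp)) x
  have : gradient (fun x => c * u x) x = c • gradient u x := by
    unfold gradient
    rw [fderiv_const_mul hd]
    simp
  rw [this, norm_smul, Real.mul_rpow (norm_nonneg _) (norm_nonneg _), Real.norm_of_nonneg hc]

lemma energy_nonneg {N : ℕ} (Ω : Set (EuclideanSpace ℝ (Fin N))) (u : EuclideanSpace ℝ (Fin N) → ℝ)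
    (p : ℝ) : 0 ≤ ∫ x in Ω, ‖gradient u x‖ ^ p :=
  integral_nonneg fun x => by positivity

lemma Adm.bdd {N : ℕ} {Ω : Set (EuclideanSpace ℝ (Fin N))} {u : EuclideanSpace ℝ (Fin N) → ℝ}
    (h : Adm Ω u) : BddAbove ((fun x => |u x|) '' Ω) := by
  obtain ⟨C, hC⟩ := h.2.1.exists_bound_of_continuous h.1.continuous
  exact ⟨C, by rintro _ ⟨x, _, rfl⟩; exact hC x⟩

lemma Adm.integrable {N : ℕ} {Ω : Set (EuclideanSpace ℝ (Fin N))}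
    {u : EuclideanSpace ℝ (Fin N) → ℝ} (h : Adm Ω u) {q : ℝ} (hq : 1 ≤ q) :
    IntegrableOn (fun x => |u x| ^ q) Ω := by
  apply Integrable.integrableOn
  apply Continuous.integrable_of_hasCompactSupport
  · exact h.1.continuous.abs.rpow_const (fun x => Or.inr (by linarith))
  · refine h.2.1.comp_left (g := fun t : ℝ => |t| ^ q) ?_
    simp [Real.zero_rpow (by linarith : q ≠ 0)]

lemma lower_int {N : ℕ} {Ω : Set (EuclideanSpace ℝ (Fin N))} (hΩo : IsOpen Ω)
    (hΩb : Bornology.IsBounded Ω) (hΩne : Ω.Nonempty)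
    {u : EuclideanSpace ℝ (Fin N) → ℝ} (h : Adm Ω u) (hS : sSup ((fun x => |u x|) '' Ω) = 1)
    {r : ℝ} (hr0 : 0 < r) (hr : r < 1) :
    ∃ m : ℝ, 0 < m ∧ ∀ q : ℝ, 1 ≤ q → r ^ q * m ≤ ∫ x in Ω, |u x| ^ q := by
  set T := Ω ∩ {x | r < |u x|} with hT
  have hTo : IsOpen T := hΩo.inter (isOpen_lt continuous_const h.1.continuous.abs)
  have hTne : T.Nonempty := by
    obtain ⟨_, ⟨x, hx, rfl⟩, hrx⟩ := exists_lt_of_lt_csSup (hΩne.image (fun x => |u x|)) (hS ▸ hr)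
    exact ⟨x, hx, hrx⟩
  have hfin : volume T < ⊤ := (measure_mono Set.inter_subset_left).trans_lt hΩb.measure_lt_top
  refine ⟨volume.real T, ENNReal.toReal_pos (hTo.measure_pos _ hTne).ne' hfin.ne, fun q hq => ?_⟩
  calc r ^ q * volume.real T = ∫ x in T, r ^ q := by simp [mul_comm]
    _ ≤ ∫ x in T, |u x| ^ q := by
      apply setIntegral_mono_on (integrableOn_const hfin.ne)
        ((h.integrable hq).mono_set Set.inter_subset_left) hTo.measurableSet
      intro x hx
      exact Real.rpow_le_rpow hr0.le hx.2.le (by linarith)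
    _ ≤ _ := setIntegral_mono_set (h.integrable hq)
        (ae_of_all _ fun x => by positivity) (ae_of_all _ Set.inter_subset_left)

lemma upper_int {N : ℕ} {Ω : Set (EuclideanSpace ℝ (Fin N))} (hΩo : IsOpen Ω)
    (hΩb : Bornology.IsBounded Ω)
    {u : EuclideanSpace ℝ (Fin N) → ℝ} (h : Adm Ω u) {q : ℝ} (hq : 1 ≤ q) :
    ∫ x in Ω, |u x| ^ q ≤ (sSup ((fun x => |u x|) '' Ω)) ^ q * volume.real Ω := by
  calc ∫ x in Ω, |u x| ^ q ≤ ∫ x in Ω, (sSup ((fun x => |u x|) '' Ω)) ^ q := by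
        apply setIntegral_mono_on (h.integrable hq) (integrableOn_const hΩb.measure_lt_top.ne)
          hΩo.measurableSet
        intro x hx
        exact Real.rpow_le_rpow (abs_nonneg _) (le_csSup h.bdd ⟨x, hx, rfl⟩) (by linarith)
    _ = _ := by simp [mul_comm]

open scoped Pointwise in
lemma sup_smul {N : ℕ} {Ω : Set (EuclideanSpace ℝ (Fin N))}
    (u : EuclideanSpace ℝ (Fin N) → ℝ) {c : ℝ} (hc : 0 ≤ c) :
    sSup ((fun x => |c * u x|) '' Ω) = c * sSup ((fun x => |u x|) '' Ω) := by
  have : (fun x => |c * u x|) '' Ω = c • ((fun x => |u x|) '' Ω) := by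
    rw [← Set.image_smul, Set.image_image]
    simp [abs_mul, abs_of_nonneg hc]
  rw [this, Real.sSup_smul_of_nonneg hc, smul_eq_mul]

lemma LambdaP_le {N : ℕ} {Ω : Set (EuclideanSpace ℝ (Fin N))}
    {u : EuclideanSpace ℝ (Fin N) → ℝ} (h : Adm Ω u) {p : ℝ}
    (hM : 0 < sSup ((fun x => |u x|) '' Ω)) :
    LambdaP Ω p ≤ ((sSup ((fun x => |u x|) '' Ω))⁻¹) ^ p * ∫ x in Ω, ‖gradient u x‖ ^ p := by
  have hc := (inv_pos.2 hM).le
  rw [← energy_smul h hc]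
  apply csInf_le
  · exact ⟨0, by rintro _ ⟨v, _, _, _, _, rfl⟩; exact energy_nonneg _ _ _⟩
  · obtain ⟨h1, h2, h3⟩ := h.smul (sSup ((fun x => |u x|) '' Ω))⁻¹
    exact ⟨_, h1, h2, h3, by rw [sup_smul u hc, inv_mul_cancel₀ hM.ne'], rfl⟩

lemma mem_lambdaQ {N : ℕ} {Ω : Set (EuclideanSpace ℝ (Fin N))}
    {u : EuclideanSpace ℝ (Fin N) → ℝ} (h : Adm Ω u) {p q : ℝ} (hq : 1 ≤ q)
    (hI : 0 < ∫ x in Ω, |u x| ^ q) :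
    ((∫ x in Ω, |u x| ^ q) ^ (-1 / q)) ^ p * (∫ x in Ω, ‖gradient u x‖ ^ p) ∈
    { c : ℝ | ∃ u : EuclideanSpace ℝ (Fin N) → ℝ,
    ContDiff ℝ (⊤ : ℕ∞) u ∧ HasCompactSupport u ∧ tsupport u ⊆ Ω ∧
    (∫ x in Ω, |u x| ^ q) ^ (1 / q) = 1 ∧
    c = ∫ x in Ω, ‖gradient u x‖ ^ p } := by
  set I := ∫ x in Ω, |u x| ^ q with hIdef
  have hc : 0 < I ^ (-1 / q) := by positivity
  rw [← energy_smul h hc.le]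
  obtain ⟨h1, h2, h3⟩ := h.smul (I ^ (-1 / q))
  refine ⟨_, h1, h2, h3, ?_, rfl⟩
  have : ∀ x, |I ^ (-1 / q) * u x| ^ q = I⁻¹ * |u x| ^ q := by
    intro x
    rw [abs_mul, Real.mul_rpow (abs_nonneg _) (abs_nonneg _), abs_of_pos hc,
      ← Real.rpow_mul hI.le, div_mul_cancel₀ _ (by linarith : q ≠ 0), Real.rpow_neg_one]
  simp_rw [this]
  rw [integral_const_mul, ← hIdef, inv_mul_cancel₀ hI.ne', Real.one_rpow]

lemma bddQ {N : ℕ} (Ω : Set (EuclideanSpace ℝ (Fin N))) (p q : ℝ) :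
    BddBelow { c : ℝ | ∃ u : EuclideanSpace ℝ (Fin N) → ℝ,
    ContDiff ℝ (⊤ : ℕ∞) u ∧ HasCompactSupport u ∧ tsupport u ⊆ Ω ∧
    (∫ x in Ω, |u x| ^ q) ^ (1 / q) = 1 ∧
    c = ∫ x in Ω, ‖gradient u x‖ ^ p } :=
  ⟨0, by rintro _ ⟨v, _, _, _, _, rfl⟩; exact energy_nonneg _ _ _⟩

lemma exists_adm {N : ℕ} {Ω : Set (EuclideanSpace ℝ (Fin N))} (hΩo : IsOpen Ω)
    (hΩne : Ω.Nonempty) : ∃ u, Adm Ω u ∧ sSup ((fun x => |u x|) '' Ω) = 1 := by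
  obtain ⟨x, hx⟩ := hΩne
  obtain ⟨f, h1, h2, h3, h4, h5⟩ := exists_contDiff_tsupport_subset (n := (⊤ : ℕ∞)) (hΩo.mem_nhds hx)
  refine ⟨f, ⟨h3, h2, h1⟩, ?_⟩
  apply IsGreatest.csSup_eq
  refine ⟨⟨x, hx, by simp [h5]⟩, ?_⟩
  rintro _ ⟨y, _, rfl⟩
  have := h4 ⟨y, rfl⟩
  simpa [abs_of_nonneg this.1] using this.2

lemma tendsto_pow_q {a : ℝ} (ha : 0 < a) (p : ℝ) :
    Tendsto (fun q : ℝ => (a ^ (-1 / q)) ^ p) atTop (𝓝 1) := by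
  have h0 : Tendsto (fun q : ℝ => -1 / q) atTop (𝓝 0) := tendsto_const_nhds.div_atTop tendsto_id
  have h1 : Tendsto (fun q : ℝ => a ^ (-1 / q)) atTop (𝓝 1) := by
    simpa using (tendsto_const_nhds (x := a)).rpow h0 (Or.inl ha.ne')
  simpa using h1.rpow_const (p := p) (Or.inl one_ne_zero)

theorem stmt0 {N : ℕ} (hN : 2 ≤ N) (Ω : Set (EuclideanSpace ℝ (Fin N)))
    (hΩo : IsOpen Ω) (hΩb : Bornology.IsBounded Ω) (hΩne : Ω.Nonempty)
    (p : ℝ) (hp : (N : ℝ) < p) :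
    Tendsto (fun q => lambdaQ Ω p q) atTop (𝓝 (LambdaP Ω p)) := by
  have hp0 : 0 < p := lt_of_le_of_lt (Nat.cast_nonneg N) hp
  obtain ⟨w, hw, hw1⟩ := exists_adm hΩo hΩne
  have hV : 0 < volume.real Ω :=
    ENNReal.toReal_pos (hΩo.measure_pos _ hΩne).ne' hΩb.measure_lt_top.ne
  set V := volume.real Ω with hVdef
  have hlow : ∀ q : ℝ, 1 ≤ q → (V ^ (-1 / q)) ^ p * LambdaP Ω p ≤ lambdaQ Ω p q := by
    intro q hq
    have hq0 : 0 < q := by linarith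
    obtain ⟨m, hm, hmq⟩ := lower_int hΩo hΩb hΩne hw hw1 (r := 1 / 2) (by norm_num) (by norm_num)
    have hpos : 0 < ∫ x in Ω, |w x| ^ q := lt_of_lt_of_le (by positivity) (hmq q hq)
    apply le_csInf ⟨_, mem_lambdaQ hw (p := p) hq hpos⟩
    rintro _ ⟨u, h1, h2, h3, h4, rfl⟩
    have hu : Adm Ω u := ⟨h1, h2, h3⟩
    have hI0 : 0 ≤ ∫ x in Ω, |u x| ^ q := integral_nonneg fun x => by positivity
    have hI : ∫ x in Ω, |u x| ^ q = 1 := by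
      have := congrArg (fun t : ℝ => t ^ q) h4
      simpa [← Real.rpow_mul hI0, hq0.ne'] using this
    have hup := upper_int hΩo hΩb hu hq
    rw [hI] at hup
    have hM0 : 0 ≤ sSup ((fun x => |u x|) '' Ω) :=
      Real.sSup_nonneg (by rintro _ ⟨x, _, rfl⟩; exact abs_nonneg _)
    have hM : 0 < sSup ((fun x => |u x|) '' Ω) := by
      rcases hM0.eq_or_lt with h | h
      · rw [← h, Real.zero_rpow hq0.ne'] at hup
        norm_num at hup
      · exact h
    have hL := LambdaP_le hu (p := p) hM
    set M := sSup ((fun x => |u x|) '' Ω)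
    have hVM : V ^ (-1 / q) ≤ M := by
      have h5 : V⁻¹ ≤ M ^ q := by
        rw [inv_le_iff_one_le_mul₀ hV]; exact hup
      have h6 := Real.rpow_le_rpow (inv_pos.2 hV).le h5 (z := 1 / q) (by positivity)
      rw [← Real.rpow_mul hM0, mul_one_div_cancel hq0.ne', Real.rpow_one,
        ← Real.rpow_neg_one, ← Real.rpow_mul hV.le] at h6
      convert h6 using 2
      ring
    have hE := energy_nonneg Ω u p
    calc (V ^ (-1 / q)) ^ p * LambdaP Ω p
        ≤ (V ^ (-1 / q)) ^ p * ((M⁻¹) ^ p * ∫ x in Ω, ‖gradient u x‖ ^ p) := by gcongr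
      _ ≤ M ^ p * ((M⁻¹) ^ p * ∫ x in Ω, ‖gradient u x‖ ^ p) := by gcongr
      _ = _ := by
        rw [← mul_assoc, ← Real.mul_rpow hM0 (by positivity), mul_inv_cancel₀ hM.ne',
          Real.one_rpow, one_mul]
  rw [tendsto_order]
  constructor
  · intro a ha
    have ht : Tendsto (fun q : ℝ => (V ^ (-1 / q)) ^ p * LambdaP Ω p) atTop (𝓝 (LambdaP Ω p)) := by
      simpa using (tendsto_pow_q hV p).mul_const (LambdaP Ω p)
    filter_upwards [ht.eventually_const_lt ha, eventually_ge_atTop 1] with q h1 h2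
    exact h1.trans_le (hlow q h2)
  · intro b hb
    unfold LambdaP at hb
    obtain ⟨_, ⟨u, h1, h2, h3, h4, rfl⟩, hub⟩ :=
      exists_lt_of_csInf_lt (by exact ⟨_, w, hw.1, hw.2.1, hw.2.2, hw1, rfl⟩) hb
    have hu : Adm Ω u := ⟨h1, h2, h3⟩
    have hE := energy_nonneg Ω u p
    set E := ∫ x in Ω, ‖gradient u x‖ ^ p with hEdef
    have hr : ∃ r : ℝ, 0 < r ∧ r < 1 ∧ (r⁻¹) ^ p * E < b := by
      have ht : Tendsto (fun r : ℝ => (r⁻¹) ^ p * E) (𝓝[<] 1) (𝓝 E) := by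
        have h5 : Tendsto (fun r : ℝ => r⁻¹) (𝓝 1) (𝓝 1) := by
          simpa using (tendsto_inv₀ (one_ne_zero (α := ℝ)))
        have h6 := (h5.rpow_const (p := p) (Or.inl one_ne_zero)).mul_const E
        simp only [Real.one_rpow, one_mul] at h6
        exact h6.mono_left nhdsWithin_le_nhds
      have h7 : ∀ᶠ r : ℝ in 𝓝[<] 1, r ∈ Set.Ioo (0 : ℝ) 1 := Ioo_mem_nhdsLT (by norm_num)
      obtain ⟨r, ha, hb⟩ := ((ht.eventually_lt_const hub).and h7).exists
      exact ⟨r, hb.1, hb.2, ha⟩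
    obtain ⟨r, hr0, hr1, hrb⟩ := hr
    obtain ⟨m, hm, hmq⟩ := lower_int hΩo hΩb hΩne hu h4 hr0 hr1
    have ht : Tendsto (fun q : ℝ => (m ^ (-1 / q)) ^ p * ((r⁻¹) ^ p * E)) atTop
        (𝓝 ((r⁻¹) ^ p * E)) := by
      simpa using (tendsto_pow_q hm p).mul_const ((r⁻¹) ^ p * E)
    filter_upwards [ht.eventually_lt_const hrb, eventually_ge_atTop 1] with q hq1 hq
    have hq0 : 0 < q := by linarith
    have hpos : 0 < r ^ q * m := by positivity
    have hI := hmq q hq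
    have hmem := mem_lambdaQ hu (p := p) hq (hpos.trans_le hI)
    refine lt_of_le_of_lt ((csInf_le (bddQ Ω p q) hmem).trans ?_) hq1
    have hle : (∫ x in Ω, |u x| ^ q) ^ (-1 / q) ≤ m ^ (-1 / q) * r⁻¹ := by
      calc (∫ x in Ω, |u x| ^ q) ^ (-1 / q) ≤ (r ^ q * m) ^ (-1 / q) :=
            Real.rpow_le_rpow_of_nonpos hpos hI
              (div_nonpos_of_nonpos_of_nonneg (by norm_num) hq0.le)
        _ = _ := by
          rw [Real.mul_rpow (by positivity) hm.le, ← Real.rpow_mul hr0.le,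
            mul_div_cancel₀ _ hq0.ne', Real.rpow_neg_one, mul_comm]
    have hI0 : 0 ≤ (∫ x in Ω, |u x| ^ q) ^ (-1 / q) := Real.rpow_nonneg (hpos.le.trans hI) _
    rw [← mul_assoc, ← Real.mul_rpow (by positivity) (by positivity)]
    gcongr
end

section
/- For every p > N and every R > 0, Λ_p(B_R) = N ω_N R^{N−p} ((p−N)/(p−1))^{p−1}, where B_R is the open Euclidean ball of radius R centered at the origin of ℝ^N. -/
open MeasureTheory Filter Topology Metric

lemma aux_ray {N : ℕ} {u : EuclideanSpace ℝ (Fin N) → ℝ} (hu : ContDiff ℝ (⊤ : ℕ∞) u)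
    (hc : HasCompactSupport u) (x0 θ : EuclideanSpace ℝ (Fin N)) (hθ : ‖θ‖ = 1) :
    ENNReal.ofReal |u x0| ≤ ∫⁻ r in Set.Ioi (0 : ℝ), ENNReal.ofReal ‖fderiv ℝ u (x0 + r • θ)‖ := by
  set f : ℝ → ℝ := fun r => u (x0 + r • θ) with hf
  have hf1 : ContDiff ℝ 1 f := by
    have : ContDiff ℝ 1 u := hu.of_le (by exact_mod_cast le_top)
    exact this.comp (by fun_prop)
  have hfc : HasCompactSupport f := by
    refine hc.comp_isClosedEmbedding (g := fun r : ℝ => x0 + r • θ) ?_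
    refine Isometry.isClosedEmbedding ?_
    refine Isometry.of_dist_eq fun a b => ?_
    rw [dist_add_left, dist_eq_norm, ← sub_smul, norm_smul, hθ, mul_one, dist_eq_norm]
  have h := hfc.integral_Ioi_deriv_eq hf1 0
  have h0 : f 0 = u x0 := by simp [hf]
  have hd : ∀ r, ‖deriv f r‖ ≤ ‖fderiv ℝ u (x0 + r • θ)‖ := by
    intro r
    have h1 : HasFDerivAt u (fderiv ℝ u (x0 + r • θ)) (x0 + r • θ) :=
      (hu.differentiable (by simp)).differentiableAt.hasFDerivAt
    have h2 : HasDerivAt (fun r : ℝ => x0 + r • θ) θ r := by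
      simpa using ((hasDerivAt_id r).smul_const θ).const_add x0
    have h3 := h1.comp_hasDerivAt r h2
    have h4 : deriv f r = fderiv ℝ u (x0 + r • θ) θ := h3.deriv
    rw [h4]
    simpa [hθ] using (fderiv ℝ u (x0 + r • θ)).le_opNorm θ
  calc ENNReal.ofReal |u x0| = ‖∫ x in Set.Ioi (0:ℝ), deriv f x‖ₑ := by
        rw [h, h0, ← ofReal_norm]; simp
    _ ≤ ∫⁻ x in Set.Ioi (0:ℝ), ‖deriv f x‖ₑ := enorm_integral_le_lintegral_enorm _
    _ ≤ _ := by
        refine lintegral_mono fun r => ?_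
        rw [← ofReal_norm]
        exact ENNReal.ofReal_le_ofReal (hd r)

lemma aux_polar {N : ℕ} (hN : 2 ≤ N) {u : EuclideanSpace ℝ (Fin N) → ℝ}
    (hu : ContDiff ℝ (⊤ : ℕ∞) u)
    (hc : HasCompactSupport u) (x0 : EuclideanSpace ℝ (Fin N)) :
    (N * volume (ball (0 : EuclideanSpace ℝ (Fin N)) 1)) * ENNReal.ofReal |u x0| ≤
    ∫⁻ y : EuclideanSpace ℝ (Fin N),
      ENNReal.ofReal (‖y‖ ^ (1 - (N:ℝ)) * ‖fderiv ℝ u (x0 + y)‖) := by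
  have : Nonempty (Fin N) := ⟨⟨0, by omega⟩⟩
  have hcont : Continuous (fderiv ℝ u) := hu.continuous_fderiv (by simp)
  set F : (EuclideanSpace ℝ (Fin N)) → ENNReal := fun y => ENNReal.ofReal (‖y‖ ^ (1 - (N:ℝ)) * ‖fderiv ℝ u (x0 + y)‖) with hF
  have hFm : Measurable F := by
    have : Measurable fun y : (EuclideanSpace ℝ (Fin N)) => ‖fderiv ℝ u (x0 + y)‖ := by
      have : Continuous fun y : (EuclideanSpace ℝ (Fin N)) => ‖fderiv ℝ u (x0 + y)‖ := by fun_prop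
      exact this.measurable
    fun_prop
  have e1 : ∫⁻ y, F y = ∫⁻ y : ({(0:(EuclideanSpace ℝ (Fin N)))}ᶜ : Set (EuclideanSpace ℝ (Fin N))), F y ∂((volume : Measure (EuclideanSpace ℝ (Fin N))).comap (↑)) := by
    rw [lintegral_subtype_comap (measurableSet_singleton _).compl, restrict_compl_singleton]
  have e2 : ∫⁻ y : ({(0:(EuclideanSpace ℝ (Fin N)))}ᶜ : Set (EuclideanSpace ℝ (Fin N))), F y ∂((volume : Measure (EuclideanSpace ℝ (Fin N))).comap (↑)) =
      ∫⁻ q, F (q.2.1 • q.1.1) ∂((volume : Measure (EuclideanSpace ℝ (Fin N))).toSphere.prod (.volumeIoiPow (Module.finrank ℝ (EuclideanSpace ℝ (Fin N)) - 1))) := by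
    have := (volume : Measure (EuclideanSpace ℝ (Fin N))).measurePreserving_homeomorphUnitSphereProd.lintegral_comp_emb
      (Homeomorph.measurableEmbedding _) (fun q => F (q.2.1 • q.1.1))
    rw [← this]
    refine lintegral_congr fun y => ?_
    congr 1
    have hy : ‖(y:(EuclideanSpace ℝ (Fin N)))‖ ≠ 0 := norm_ne_zero_iff.2 y.2
    simp [smul_smul, hy]
  have e3 : ∫⁻ q, F (q.2.1 • q.1.1) ∂((volume : Measure (EuclideanSpace ℝ (Fin N))).toSphere.prod (.volumeIoiPow (Module.finrank ℝ (EuclideanSpace ℝ (Fin N)) - 1)))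
      = ∫⁻ θ, ∫⁻ r, F (r.1 • θ.1) ∂(Measure.volumeIoiPow (Module.finrank ℝ (EuclideanSpace ℝ (Fin N)) - 1)) ∂(volume : Measure (EuclideanSpace ℝ (Fin N))).toSphere := by
    rw [lintegral_prod]
    apply Measurable.aemeasurable
    apply hFm.comp
    fun_prop
  have e4 : ∀ θ : sphere (0:(EuclideanSpace ℝ (Fin N))) 1, ENNReal.ofReal |u x0| ≤
      ∫⁻ r, F (r.1 • θ.1) ∂(Measure.volumeIoiPow (Module.finrank ℝ (EuclideanSpace ℝ (Fin N)) - 1)) := by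
    intro θ
    have hθ : ‖θ.1‖ = 1 := by simp
    refine (aux_ray hu hc x0 θ.1 hθ).trans (le_of_eq ?_)
    have hm : Measurable (fun r : Set.Ioi (0:ℝ) => F (r.1 • θ.1)) := hFm.comp (by fun_prop)
    have hm2 : Measurable (fun r : Set.Ioi (0:ℝ) => ENNReal.ofReal
      (r.1 ^ (Module.finrank ℝ (EuclideanSpace ℝ (Fin N)) - 1))) := by fun_prop
    rw [Measure.volumeIoiPow, lintegral_withDensity_eq_lintegral_mul _ hm2 hm]
    rw [← lintegral_subtype_comap measurableSet_Ioi]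
    refine lintegral_congr fun r => ?_
    have hr : 0 < r.1 := r.2
    simp only [Pi.mul_apply, hF]
    rw [← ENNReal.ofReal_mul (by positivity)]
    congr 1
    rw [norm_smul, hθ, mul_one, Real.norm_of_nonneg hr.le, ← mul_assoc, ← Real.rpow_natCast,
      ← Real.rpow_add hr]
    have : ((Module.finrank ℝ (EuclideanSpace ℝ (Fin N)) - 1 : ℕ) : ℝ) + (1 - (N:ℝ)) = 0 := by
      simp only [finrank_euclideanSpace, Fintype.card_fin]
      push_cast [Nat.cast_sub (show 1 ≤ N by omega)]
      ring
    rw [this]; simp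
  rw [e1, e2, e3]
  calc _ = ∫⁻ θ : sphere (0:(EuclideanSpace ℝ (Fin N))) 1, ENNReal.ofReal |u x0| ∂(volume : Measure (EuclideanSpace ℝ (Fin N))).toSphere := by
        rw [lintegral_const, Measure.toSphere_apply_univ, mul_comm]
        simp
    _ ≤ _ := lintegral_mono e4

lemma aux_int {N : ℕ} (hN : 2 ≤ N) {R s : ℝ} (hR : 0 < R) (hs : -(N:ℝ) < s) :
    IntegrableOn (fun x : EuclideanSpace ℝ (Fin N) => ‖x‖ ^ s) (ball 0 R) ∧
    ∫ x in ball (0 : EuclideanSpace ℝ (Fin N)) R, ‖x‖ ^ s =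
      N * (volume (ball (0 : EuclideanSpace ℝ (Fin N)) 1)).toReal * (R ^ (s + N) / (s + N)) := by
  have : Nonempty (Fin N) := ⟨⟨0, by omega⟩⟩
  have key : ∀ y : ℝ, 0 < y → y ^ (N - 1) • y ^ s = y ^ (s + N - 1) := by
    intro y hy
    rw [smul_eq_mul, ← Real.rpow_natCast, ← Real.rpow_add hy]
    push_cast [Nat.cast_sub (show 1 ≤ N by omega)]
    ring_nf
  constructor
  · have := integrableOn_fun_norm_addHaar (E := EuclideanSpace ℝ (Fin N)) volume
      (f := fun y : ℝ => y ^ s) (r := R)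
    rw [this]
    simp only [finrank_euclideanSpace, Fintype.card_fin]
    rw [integrableOn_congr_fun (g := fun y => y ^ (s + N - 1)) (fun y hy => key y hy.1) measurableSet_Ioo]
    rw [intervalIntegral.integrableOn_Ioo_rpow_iff hR]
    linarith
  · have h := integral_fun_norm_addHaar (E := EuclideanSpace ℝ (Fin N)) volume
      (fun y : ℝ => (Set.Iio R).indicator (fun y => y ^ s) y)
    rw [← integral_indicator measurableSet_ball]
    have h1 : ∀ x : EuclideanSpace ℝ (Fin N), (ball (0 : EuclideanSpace ℝ (Fin N)) R).indicator (fun x => ‖x‖ ^ s) x =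
        (Set.Iio R).indicator (fun y => y ^ s) ‖x‖ := by
      intro x; simp [Set.indicator]
    simp_rw [h1]
    rw [h]
    simp only [finrank_euclideanSpace, Fintype.card_fin]
    have h2 : ∫ y in Set.Ioi (0:ℝ), y ^ (N-1) • (Set.Iio R).indicator (fun y => y ^ s) y =
        R ^ (s + N) / (s + N) := by
      have : ∫ y in Set.Ioi (0:ℝ), y ^ (N-1) • (Set.Iio R).indicator (fun y => y ^ s) y =
          ∫ y in Set.Ioi (0:ℝ), (Set.Iio R).indicator (fun y => y ^ (s + N - 1)) y := by
        refine setIntegral_congr_fun measurableSet_Ioi fun y hy => ?_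
        by_cases hyR : y < R
        · simpa [Set.indicator, hyR] using key y hy
        · simp [Set.indicator, hyR]
      rw [this, setIntegral_indicator measurableSet_Iio, Set.Ioi_inter_Iio,
        ← integral_Ioc_eq_integral_Ioo, ← intervalIntegral.integral_of_le hR.le,
        integral_rpow (Or.inl (by linarith))]
      rw [Real.zero_rpow (by linarith)]
      ring_nf
    rw [h2]
    simp [Measure.real, mul_assoc]

lemma aux_int_shift {N : ℕ} (hN : 2 ≤ N) {R s : ℝ} (hR : 0 < R) (hs : -(N:ℝ) < s)
    {x0 : EuclideanSpace ℝ (Fin N)} (hx0 : x0 ∈ ball (0 : EuclideanSpace ℝ (Fin N)) R) :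
    IntegrableOn (fun x : EuclideanSpace ℝ (Fin N) => ‖x - x0‖ ^ s) (ball 0 R) := by
  have h := (aux_int hN (show 0 < 2 * R by linarith) hs).1
  rw [← integrable_indicator_iff measurableSet_ball] at h
  have h2 := (h.comp_sub_right x0).integrableOn (s := ball 0 R)
  refine h2.congr_fun (fun x hx => ?_) measurableSet_ball
  have : ‖x - x0‖ < 2 * R := by
    have := norm_sub_le x x0
    simp at hx hx0
    linarith
  simp [Set.indicator, this]

lemma aux_rearr {N : ℕ} (hN : 2 ≤ N) {R s : ℝ} (hR : 0 < R) (hs : -(N:ℝ) < s) (hs0 : s < 0)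
    {x0 : EuclideanSpace ℝ (Fin N)} (hx0 : x0 ∈ ball (0 : EuclideanSpace ℝ (Fin N)) R) :
    ∫ x in ball (0 : EuclideanSpace ℝ (Fin N)) R, ‖x - x0‖ ^ s ≤
      ∫ x in ball (0 : EuclideanSpace ℝ (Fin N)) R, ‖x‖ ^ s := by
  have i1 := aux_int_shift hN hR hs hx0
  have i2 := (aux_int hN hR hs).1
  have ic : IntegrableOn (fun _ : EuclideanSpace ℝ (Fin N) => R ^ s) (ball 0 R) :=
    integrableOn_const (by finiteness)
  have key : ∫ x in ball (0 : EuclideanSpace ℝ (Fin N)) R, (‖x - x0‖ ^ s - R ^ s) ≤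
      ∫ x in ball (0 : EuclideanSpace ℝ (Fin N)) R, (‖x‖ ^ s - R ^ s) := by
    have j1 : IntegrableOn (fun x : EuclideanSpace ℝ (Fin N) => ‖x - x0‖ ^ s - R ^ s) (ball 0 R) :=
      i1.sub ic
    have j2 : IntegrableOn (fun x : EuclideanSpace ℝ (Fin N) => ‖x‖ ^ s - R ^ s) (ball 0 R) :=
      i2.sub ic
    rw [← integrable_indicator_iff measurableSet_ball] at j1 j2
    rw [← integral_indicator measurableSet_ball, ← integral_indicator measurableSet_ball,
      ← integral_add_right_eq_self _ x0]
    refine integral_mono (j1.comp_add_right x0) j2 fun y => ?_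
    simp only [Set.indicator, mem_ball_zero_iff, add_sub_cancel_right]
    simp only [mem_ball_zero_iff] at hx0
    by_cases h1 : ‖y‖ < R <;> by_cases h2 : ‖y + x0‖ < R
    · simp [h1, h2]
    · simp only [h1, h2, if_true, if_false]
      have hy : 0 < ‖y‖ := by
        rw [norm_pos_iff]; rintro rfl; simp at h2; linarith
      have := Real.rpow_le_rpow_of_nonpos hy h1.le hs0.le
      linarith
    · simp only [h1, h2, if_true, if_false]
      have := Real.rpow_le_rpow_of_nonpos hR (not_lt.1 h1) hs0.le
      linarith
    · simp [h1, h2]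
  rw [integral_sub i1 ic, integral_sub i2 ic] at key
  linarith

lemma aux_young {a b p : ℝ} (ha : 0 ≤ a) (hb : 0 ≤ b) (hp : 1 < p) :
    p * b ^ (p - 1) * a - (p - 1) * b ^ p ≤ a ^ p := by
  rcases hb.eq_or_lt with rfl | hb
  · rw [Real.zero_rpow (by linarith), Real.zero_rpow (by linarith)]
    simpa using Real.rpow_nonneg ha p
  · have h := one_add_mul_self_le_rpow_one_add (s := a / b - 1)
      (by have : 0 ≤ a / b := by positivity
          linarith) hp.le
    rw [add_sub_cancel, Real.div_rpow ha hb.le, le_div_iff₀ (by positivity)] at h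
    have h2 : b ^ p = b ^ (p - 1) * b := by
      rw [← Real.rpow_add_one hb.ne']; ring_nf
    refine le_trans (le_of_eq ?_) h
    rw [h2]
    field_simp
    ring

lemma norm_gradient_eq {N : ℕ} (u : EuclideanSpace ℝ (Fin N) → ℝ) (x : EuclideanSpace ℝ (Fin N)) :
    ‖gradient u x‖ = ‖fderiv ℝ u x‖ := by
  simp [gradient]

lemma aux_I1 {N : ℕ} (hN : 2 ≤ N) {R : ℝ} (hR : 0 < R)
    {u : EuclideanSpace ℝ (Fin N) → ℝ}
    (hu : ContDiff ℝ (⊤ : ℕ∞) u)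
    (hc : HasCompactSupport u) (hs : tsupport u ⊆ ball 0 R)
    {x0 : EuclideanSpace ℝ (Fin N)} (hx0 : x0 ∈ ball (0 : EuclideanSpace ℝ (Fin N)) R) :
    IntegrableOn (fun x : EuclideanSpace ℝ (Fin N) =>
      ‖x - x0‖ ^ (1 - (N:ℝ)) * ‖fderiv ℝ u x‖) (ball 0 R) ∧
    N * (volume (ball (0 : EuclideanSpace ℝ (Fin N)) 1)).toReal * |u x0| ≤
     ∫ x in ball (0 : EuclideanSpace ℝ (Fin N)) R, ‖x - x0‖ ^ (1 - (N:ℝ)) * ‖fderiv ℝ u x‖ := by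
  have hcont : Continuous (fderiv ℝ u) := hu.continuous_fderiv (by simp)
  have hint : IntegrableOn (fun x : EuclideanSpace ℝ (Fin N) =>
      ‖x - x0‖ ^ (1 - (N:ℝ)) * ‖fderiv ℝ u x‖) (ball 0 R) := by
    obtain ⟨C, hC⟩ := hcont.bounded_above_of_compact_support (hc.fderiv ℝ)
    refine Integrable.mul_bdd (c := C) (aux_int_shift hN hR (by linarith) hx0)
      hcont.norm.aestronglyMeasurable ?_
    exact .of_forall fun x => by simpa using hC x
  refine ⟨hint, ?_⟩
  have h := aux_polar hN hu hc x0
  have e : ∫⁻ y : EuclideanSpace ℝ (Fin N),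
      ENNReal.ofReal (‖y‖ ^ (1 - (N:ℝ)) * ‖fderiv ℝ u (x0 + y)‖) =
      ENNReal.ofReal (∫ x in ball (0 : EuclideanSpace ℝ (Fin N)) R,
        ‖x - x0‖ ^ (1 - (N:ℝ)) * ‖fderiv ℝ u x‖) := by
    rw [ofReal_integral_eq_lintegral_ofReal hint (.of_forall fun x => by positivity)]
    rw [← lintegral_add_left_eq_self (μ := volume) _ (-x0), ← lintegral_indicator measurableSet_ball]
    refine lintegral_congr fun x => ?_
    by_cases hx : x ∈ ball (0 : EuclideanSpace ℝ (Fin N)) R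
    · rw [Set.indicator_of_mem hx]
      congr 3
      · congr 1; abel
      · congr 2; abel
    · rw [Set.indicator_of_notMem hx]
      have : fderiv ℝ u x = 0 := by
        by_contra hne
        exact hx (hs (support_fderiv_subset ℝ hne))
      simp [this]
  rw [e] at h
  rw [← ENNReal.ofReal_le_ofReal_iff (integral_nonneg fun x => by positivity)]
  refine le_trans (le_of_eq ?_) h
  rw [ENNReal.ofReal_mul (by positivity), ENNReal.ofReal_mul (by positivity), ENNReal.ofReal_toReal
    (by finiteness)]
  simp

lemma aux_alpha {N : ℕ} (hN : 2 ≤ N) {p : ℝ} (hp : (N : ℝ) < p) :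
    0 < (p - N) / (p - 1) ∧ (p - N) / (p - 1) < 1 ∧ 1 < p ∧
    ((p - N) / (p - 1) - 1) * (p - 1) = 1 - N ∧
    ((p - N) / (p - 1) - 1) * p = (p - N) / (p - 1) - N := by
  have hN' : (2:ℝ) ≤ N := by exact_mod_cast hN
  have h1 : 0 < p - 1 := by linarith
  refine ⟨div_pos (by linarith) h1, by rw [div_lt_one h1]; linarith, by linarith, ?_, ?_⟩
  · field_simp; ring
  · field_simp; ring

lemma aux_lower {N : ℕ} (hN : 2 ≤ N) {p R : ℝ} (hp : (N : ℝ) < p) (hR : 0 < R)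
    {u : EuclideanSpace ℝ (Fin N) → ℝ}
    (hu : ContDiff ℝ (⊤ : ℕ∞) u)
    (hc : HasCompactSupport u) (hs : tsupport u ⊆ ball 0 R)
    {x0 : EuclideanSpace ℝ (Fin N)} (hx0 : x0 ∈ ball (0 : EuclideanSpace ℝ (Fin N)) R) :
    (N * (volume (ball (0 : EuclideanSpace ℝ (Fin N)) 1)).toReal *
        R ^ ((N : ℝ) - p) * ((p - N) / (p - 1)) ^ (p - 1)) * (p * |u x0| - (p - 1)) ≤
     ∫ x in ball (0 : EuclideanSpace ℝ (Fin N)) R, ‖gradient u x‖ ^ p := by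
  obtain ⟨ha0, ha1, hp1, hA, hB⟩ := aux_alpha hN hp
  have hN' : (2:ℝ) ≤ N := by exact_mod_cast hN
  have hRexp : R ^ ((N : ℝ) - p) = (R ^ (-((p - N) / (p - 1)))) ^ (p - 1) := by
    rw [← Real.rpow_mul hR.le]
    congr 1
    have : p - 1 ≠ 0 := by linarith
    field_simp; ring
  simp only [norm_gradient_eq]
  rw [hRexp]
  set α := (p - N) / (p - 1) with hα
  set W := N * (volume (ball (0 : EuclideanSpace ℝ (Fin N)) 1)).toReal with hW
  set c := α * R ^ (-α) with hcdef
  have hc0 : 0 < c := by positivity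
  have hcont : Continuous (fderiv ℝ u) := hu.continuous_fderiv (by simp)
  obtain ⟨k1, k2⟩ := aux_I1 hN hR hu hc hs hx0
  have k3 := aux_int_shift hN hR (s := α - N) (by linarith) hx0
  have k4 := aux_rearr hN hR (s := α - N) (by linarith) (by linarith) hx0
  rw [(aux_int hN hR (s := α - N) (by linarith)).2, sub_add_cancel] at k4
  have k5 : IntegrableOn (fun x => ‖fderiv ℝ u x‖ ^ p) (ball 0 R) := by
    have : Continuous fun x => ‖fderiv ℝ u x‖ ^ p :=
      hcont.norm.rpow_const fun x => Or.inr (by linarith)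
    exact (this.continuousOn.integrableOn_compact (isCompact_closedBall 0 R)).mono_set
      ball_subset_closedBall
  have k6 : ∫ x in ball (0 : EuclideanSpace ℝ (Fin N)) R,
      (p * c ^ (p - 1) * (‖x - x0‖ ^ (1 - (N:ℝ)) * ‖fderiv ℝ u x‖) -
        (p - 1) * c ^ p * ‖x - x0‖ ^ (α - N)) ≤
      ∫ x in ball (0 : EuclideanSpace ℝ (Fin N)) R, ‖fderiv ℝ u x‖ ^ p := by
    refine integral_mono ((k1.const_mul _).sub (k3.const_mul _)) k5 fun x => ?_
    have := aux_young (a := ‖fderiv ℝ u x‖) (b := c * ‖x - x0‖ ^ (α - 1)) (norm_nonneg _)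
      (by positivity) hp1
    rw [Real.mul_rpow hc0.le (by positivity), Real.mul_rpow hc0.le (by positivity),
      ← Real.rpow_mul (norm_nonneg _), ← Real.rpow_mul (norm_nonneg _), hA, hB] at this
    refine le_trans (le_of_eq ?_) this
    ring
  rw [integral_sub (k1.const_mul _) (k3.const_mul _), integral_const_mul, integral_const_mul] at k6
  refine le_trans ?_ k6
  have e1 : W * (R ^ (-α)) ^ (p - 1) * α ^ (p - 1) = W * c ^ (p - 1) := by
    rw [hcdef, Real.mul_rpow ha0.le (by positivity)]; ring
  have e2 : c ^ p = c ^ (p - 1) * c := by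
    rw [← Real.rpow_add_one hc0.ne']; ring_nf
  have e3 : c * (R ^ α / α) = 1 := by
    rw [hcdef, Real.rpow_neg hR.le]; field_simp
  have f1 := mul_le_mul_of_nonneg_left k2 (show 0 ≤ p * c ^ (p - 1) by positivity)
  have f2 := mul_le_mul_of_nonneg_left k4
    (show 0 ≤ (p - 1) * c ^ p from mul_nonneg (by linarith) (by positivity))
  have e4 : (p - 1) * c ^ p * (W * (R ^ α / α)) = (p - 1) * c ^ (p - 1) * W := by
    rw [e2]; linear_combination (p - 1) * c ^ (p - 1) * W * e3
  rw [e1]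
  linarith

lemma aux_upper {N : ℕ} (hN : 2 ≤ N) {p R : ℝ} (hp : (N : ℝ) < p) (hR : 0 < R)
    {α δ : ℝ} (hα : α = (p - N) / (p - 1)) (hδ : 0 < δ) (hδR : δ < R / 2) :
    ∃ u : EuclideanSpace ℝ (Fin N) → ℝ,
    ContDiff ℝ (⊤ : ℕ∞) u ∧ HasCompactSupport u ∧ tsupport u ⊆ ball 0 R ∧
    sSup ((fun x => |u x|) '' (ball 0 R)) = 1 ∧
    ∫ x in ball (0 : EuclideanSpace ℝ (Fin N)) R, ‖gradient u x‖ ^ p ≤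
      (α / ((R - δ) ^ α - δ ^ α)) ^ p *
        (N * (volume (ball (0 : EuclideanSpace ℝ (Fin N)) 1)).toReal * (R ^ α / α)) := by
  obtain ⟨ha0, ha1, hp1, hA, hB⟩ := aux_alpha hN hp
  rw [← hα] at ha0 ha1 hA hB
  have hN' : (2:ℝ) ≤ N := by exact_mod_cast hN
  let χ : ContDiffBump (R / 2 : ℝ) := ⟨R / 2 - δ, R / 2 - δ / 2, by linarith, by linarith⟩
  have hχ0 : ∀ r, r ≤ δ / 2 → χ r = 0 := by
    intro r hr
    apply χ.zero_of_le_dist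
    change R / 2 - δ / 2 ≤ _
    rw [Real.dist_eq, abs_of_nonpos (by linarith)]; linarith
  have hχR : ∀ r, R - δ / 2 ≤ r → χ r = 0 := by
    intro r hr
    apply χ.zero_of_le_dist
    change R / 2 - δ / 2 ≤ _
    rw [Real.dist_eq, abs_of_nonneg (by linarith)]; linarith
  have hχ1 : ∀ r ∈ Set.Icc δ (R - δ), χ r = 1 := by
    intro r hr
    apply χ.one_of_mem_closedBall
    change dist _ _ ≤ R / 2 - δ
    rw [Real.dist_eq, abs_le]
    constructor <;> linarith [hr.1, hr.2]
  set g : ℝ → ℝ := fun r => χ r * (α * r ^ (α - 1)) with hg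
  have hg0 : ∀ r, r ≤ δ / 2 → g r = 0 := fun r hr => by simp [hg, hχ0 r hr]
  have hgR : ∀ r, R - δ / 2 ≤ r → g r = 0 := fun r hr => by simp [hg, hχR r hr]
  have hgnn : ∀ r, 0 ≤ g r := by
    intro r
    rcases le_or_gt r 0 with h | h
    · rw [hg0 r (by linarith)]
    · exact mul_nonneg χ.nonneg (by positivity)
  have hgle : ∀ r, 0 ≤ r → g r ≤ α * r ^ (α - 1) := fun r hr =>
    mul_le_of_le_one_left (by positivity) χ.le_one
  have hgs : ContDiff ℝ (⊤ : ℕ∞) g := by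
    rw [contDiff_iff_contDiffAt]
    intro r
    rcases lt_or_ge r (δ / 2) with h | h
    · refine (contDiffAt_const (c := (0:ℝ))).congr_of_eventuallyEq ?_
      filter_upwards [Iio_mem_nhds h] with t ht using hg0 t (le_of_lt ht)
    · have hr : r ≠ 0 := by linarith
      exact χ.contDiffAt.mul (contDiffAt_const.mul (contDiffAt_id.rpow_const_of_ne hr))
  have hgc : Continuous g := hgs.continuous
  have hii : ∀ a b, IntervalIntegrable g volume a b := fun a b => hgc.intervalIntegrable a b
  set I := ∫ t in (0:ℝ)..R, g t with hI
  have hδRα : δ ^ α < (R - δ) ^ α := Real.rpow_lt_rpow hδ.le (by linarith) ha0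
  have hIge : (R - δ) ^ α - δ ^ α ≤ I := by
    have h1 : ∫ t in δ..(R - δ), g t = (R - δ) ^ α - δ ^ α := by
      have : ∫ t in δ..(R - δ), g t = ∫ t in δ..(R - δ), α * t ^ (α - 1) := by
        refine intervalIntegral.integral_congr fun t ht => ?_
        rw [Set.uIcc_of_le (by linarith)] at ht
        simp [hg, hχ1 t ht]
      rw [this, intervalIntegral.integral_const_mul, integral_rpow (Or.inl (by linarith))]
      simp only [sub_add_cancel]
      field_simp
    rw [← h1]
    exact intervalIntegral.integral_mono_interval hδ.le (by linarith) (by linarith)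
      (.of_forall hgnn) (hii _ _)
  have hIpos : 0 < I := by linarith
  set φ : ℝ → ℝ := fun r => (∫ t in r..R, g t) / I with hφ
  have hφd : ∀ r, HasDerivAt φ (-(g r) / I) r := by
    intro r
    have := intervalIntegral.integral_hasDerivAt_left (hii r R)
      hgc.stronglyMeasurable.stronglyMeasurableAtFilter hgc.continuousAt
    exact this.div_const I
  have hφs : ContDiff ℝ (⊤ : ℕ∞) φ := by
    rw [contDiff_infty_iff_deriv]
    refine ⟨fun r => (hφd r).differentiableAt, ?_⟩
    have : deriv φ = fun r => -(g r) / I := funext fun r => (hφd r).deriv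
    rw [this]
    exact hgs.neg.div_const I
  have hφ1 : ∀ r, r ≤ δ / 2 → φ r = 1 := by
    intro r hr
    have h0 : ∫ t in r..(0:ℝ), g t = 0 := by
      rw [intervalIntegral.integral_congr (g := fun _ => (0:ℝ))]
      · simp
      · intro t ht
        apply hg0
        have := ht.2
        rcases le_total r 0 with h | h
        · simp [h] at this; linarith
        · simp [h] at this; linarith
    have := intervalIntegral.integral_add_adjacent_intervals (hii r 0) (hii 0 R)
    simp only [hφ]
    rw [← this, h0, zero_add, div_self hIpos.ne']
  have hφ0 : ∀ r, R - δ / 2 ≤ r → φ r = 0 := by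
    intro r hr
    have h0 : ∫ t in r..R, g t = 0 := by
      rw [intervalIntegral.integral_congr (g := fun _ => (0:ℝ))]
      · simp
      · intro t ht
        apply hgR
        have := ht.1
        rcases le_total r R with h | h
        · simp [h] at this; linarith
        · simp [h] at this; linarith
    simp [hφ, h0]
  have hφmem : ∀ r, 0 ≤ r → r ≤ R → 0 ≤ φ r ∧ φ r ≤ 1 := by
    intro r h0 h1
    constructor
    · exact div_nonneg (intervalIntegral.integral_nonneg h1 fun t _ => hgnn t) hIpos.le
    · simp only [hφ]
      rw [div_le_one hIpos]
      exact intervalIntegral.integral_mono_interval h0 h1 le_rfl (.of_forall hgnn) (hii _ _)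
  set u : EuclideanSpace ℝ (Fin N) → ℝ := fun x => φ ‖x‖ with hu
  have hu0 : u =ᶠ[𝓝 0] fun _ => (1:ℝ) := by
    filter_upwards [ball_mem_nhds (0 : EuclideanSpace ℝ (Fin N)) (half_pos hδ)] with x hx
    exact hφ1 _ (by simpa using (mem_ball_zero_iff.1 hx).le)
  have hus : ContDiff ℝ (⊤ : ℕ∞) u := by
    rw [contDiff_iff_contDiffAt]
    intro x
    by_cases hx : x = 0
    · subst hx
      exact contDiffAt_const.congr_of_eventuallyEq hu0
    · exact hφs.contDiffAt.comp x (contDiffAt_norm ℝ hx)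
  have hts : tsupport u ⊆ closedBall 0 (R - δ / 2) := by
    refine closure_minimal (fun x hx => ?_) isClosed_closedBall
    by_contra h
    simp only [mem_closedBall_zero_iff, not_le] at h
    exact hx (hφ0 _ h.le)
  refine ⟨u, hus, ?_, ?_, ?_, ?_⟩
  · exact (isCompact_closedBall 0 (R - δ / 2)).of_isClosed_subset (isClosed_tsupport u) hts
  · exact hts.trans (closedBall_subset_ball (by linarith))
  · refine IsGreatest.csSup_eq ⟨⟨0, by simpa using hR, ?_⟩, ?_⟩
    · simp [hu, hφ1 0 (by linarith)]
    · rintro _ ⟨x, hx, rfl⟩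
      have := hφmem ‖x‖ (norm_nonneg _) (mem_ball_zero_iff.1 hx).le
      simp only [hu]
      rw [abs_of_nonneg this.1]; exact this.2
  · simp only [norm_gradient_eq]
    have hb : ∀ x, ‖fderiv ℝ u x‖ ≤ α / ((R - δ) ^ α - δ ^ α) * ‖x‖ ^ (α - 1) := by
      intro x
      have hd : 0 < (R - δ) ^ α - δ ^ α := by linarith
      by_cases hx : x = 0
      · subst hx
        rw [hu0.fderiv_eq]
        simp only [fderiv_fun_const, Pi.zero_apply, norm_zero]
        positivity
      · have hn : HasFDerivAt (fun x : EuclideanSpace ℝ (Fin N) => ‖x‖)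
            (fderiv ℝ (fun x : EuclideanSpace ℝ (Fin N) => ‖x‖) x) x :=
          ((contDiffAt_norm ℝ (n := 1) hx).differentiableAt (by simp)).hasFDerivAt
        have h1 := (hφd ‖x‖).comp_hasFDerivAt x hn
        have h2 : fderiv ℝ u x = _ := h1.fderiv
        rw [h2, norm_smul]
        have h3 : ‖fderiv ℝ (fun x : EuclideanSpace ℝ (Fin N) => ‖x‖) x‖ ≤ 1 := by
          simpa using norm_fderiv_le_of_lipschitz ℝ (x₀ := x) (lipschitzWith_one_norm (E := EuclideanSpace ℝ (Fin N)))
        have h4 : ‖-(g ‖x‖) / I‖ = g ‖x‖ / I := by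
          rw [norm_div, norm_neg, Real.norm_of_nonneg (hgnn _), Real.norm_of_nonneg hIpos.le]
        rw [h4]
        calc g ‖x‖ / I * _ ≤ g ‖x‖ / I := mul_le_of_le_one_right (div_nonneg (hgnn _) hIpos.le) h3
          _ ≤ (α * ‖x‖ ^ (α - 1)) / ((R - δ) ^ α - δ ^ α) :=
            div_le_div₀ (by positivity) (hgle _ (norm_nonneg _)) hd hIge
          _ = _ := by ring
    have hd : 0 < (R - δ) ^ α - δ ^ α := by linarith
    obtain ⟨j1, j2⟩ := aux_int hN hR (s := α - N) (by linarith)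
    rw [sub_add_cancel] at j2
    rw [← j2, ← integral_const_mul]
    refine integral_mono_of_nonneg (.of_forall fun x => by positivity) (j1.const_mul _)
      (.of_forall fun x => ?_)
    have := Real.rpow_le_rpow (norm_nonneg _) (hb x) (show 0 ≤ p by linarith)
    rwa [Real.mul_rpow (by positivity) (by positivity), ← Real.rpow_mul (norm_nonneg _), hB] at this

theorem stmt2 {N : ℕ} (hN : 2 ≤ N) (p R : ℝ) (hp : (N : ℝ) < p) (hR : 0 < R) :
    LambdaP (ball (0 : EuclideanSpace ℝ (Fin N)) R) p =
      N * (volume (ball (0 : EuclideanSpace ℝ (Fin N)) 1)).toReal *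
        R ^ ((N : ℝ) - p) * ((p - N) / (p - 1)) ^ (p - 1) := by
  obtain ⟨ha0, ha1, hp1, hA, hB⟩ := aux_alpha hN hp
  have hN' : (2:ℝ) ≤ N := by exact_mod_cast hN
  have hbdd : BddBelow { c : ℝ | ∃ u : EuclideanSpace ℝ (Fin N) → ℝ,
    ContDiff ℝ (⊤ : ℕ∞) u ∧ HasCompactSupport u ∧
    tsupport u ⊆ ball (0 : EuclideanSpace ℝ (Fin N)) R ∧
    sSup ((fun x => |u x|) '' ball (0 : EuclideanSpace ℝ (Fin N)) R) = 1 ∧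
    c = ∫ x in ball (0 : EuclideanSpace ℝ (Fin N)) R, ‖gradient u x‖ ^ p } := by
    refine ⟨0, ?_⟩
    rintro c ⟨u, -, -, -, -, rfl⟩
    exact integral_nonneg fun x => by positivity
  unfold LambdaP
  apply le_antisymm
  · set α := (p - N) / (p - 1) with hα
    have hlim : Tendsto (fun δ : ℝ => (α / ((R - δ) ^ α - δ ^ α)) ^ p *
        (N * (volume (ball (0 : EuclideanSpace ℝ (Fin N)) 1)).toReal * (R ^ α / α)))
        (𝓝[>] 0) (𝓝 ((α / ((R - 0) ^ α - 0 ^ α)) ^ p *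
        (N * (volume (ball (0 : EuclideanSpace ℝ (Fin N)) 1)).toReal * (R ^ α / α)))) := by
      have hc : ContinuousAt (fun δ : ℝ => (α / ((R - δ) ^ α - δ ^ α)) ^ p *
        (N * (volume (ball (0 : EuclideanSpace ℝ (Fin N)) 1)).toReal * (R ^ α / α))) 0 := by
        refine ContinuousAt.mul ?_ continuousAt_const
        refine ContinuousAt.rpow_const ?_ (Or.inr (by linarith))
        refine ContinuousAt.div continuousAt_const ?_ ?_
        · refine ContinuousAt.sub ?_ ?_
          · exact ContinuousAt.rpow_const (by fun_prop) (Or.inr ha0.le)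
          · exact ContinuousAt.rpow_const (by fun_prop) (Or.inr ha0.le)
        · rw [Real.zero_rpow ha0.ne', sub_zero, sub_zero]; positivity
      exact hc.tendsto.mono_left nhdsWithin_le_nhds
    have heq : (α / ((R - 0) ^ α - 0 ^ α)) ^ p *
        (N * (volume (ball (0 : EuclideanSpace ℝ (Fin N)) 1)).toReal * (R ^ α / α)) =
        N * (volume (ball (0 : EuclideanSpace ℝ (Fin N)) 1)).toReal *
        R ^ ((N : ℝ) - p) * α ^ (p - 1) := by
      have hRexp : R ^ ((N : ℝ) - p) = ((R ^ α) ^ (p - 1))⁻¹ := by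
        rw [← Real.rpow_mul hR.le, ← Real.rpow_neg hR.le]
        congr 1
        have : p - 1 ≠ 0 := by linarith
        rw [hα]
        field_simp; ring
      rw [hRexp, Real.zero_rpow ha0.ne', sub_zero, sub_zero, Real.div_rpow ha0.le (by positivity)]
      have q1 : ∀ b : ℝ, 0 < b → b ^ p = b ^ (p - 1) * b := by
        intro b hb
        rw [← Real.rpow_add_one hb.ne']; ring_nf
      rw [q1 α ha0, q1 (R ^ α) (by positivity)]
      field_simp
    rw [← heq]
    refine ge_of_tendsto hlim ?_
    filter_upwards [Ioo_mem_nhdsGT (half_pos hR)] with δ hδ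
    obtain ⟨u, h1, h2, h3, h4, h5⟩ := aux_upper hN hp hR hα hδ.1 hδ.2
    exact (csInf_le hbdd ⟨u, h1, h2, h3, h4, rfl⟩).trans h5
  · refine le_csInf ?_ ?_
    · obtain ⟨u, h1, h2, h3, h4, h5⟩ := aux_upper hN hp hR rfl (show 0 < R / 4 by linarith)
        (by linarith)
      exact ⟨_, u, h1, h2, h3, h4, rfl⟩
    · rintro c ⟨u, h1, h2, h3, h4, rfl⟩
      set E := ∫ x in ball (0 : EuclideanSpace ℝ (Fin N)) R, ‖gradient u x‖ ^ p
      have hlow := fun x0 hx0 => aux_lower hN hp hR h1 h2 h3 (x0 := x0) hx0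
      set K := N * (volume (ball (0 : EuclideanSpace ℝ (Fin N)) 1)).toReal *
        R ^ ((N : ℝ) - p) * ((p - N) / (p - 1)) ^ (p - 1) with hK
      have hKpos : 0 < K := by
        have : 0 < (volume (ball (0 : EuclideanSpace ℝ (Fin N)) 1)).toReal :=
          ENNReal.toReal_pos (measure_ball_pos _ _ one_pos).ne' (by finiteness)
        have : (0:ℝ) < N := by linarith
        positivity
      have hsup : (1:ℝ) ≤ (E / K + (p - 1)) / p := by
        refine h4.symm.le.trans ?_
        refine csSup_le ((nonempty_ball.2 hR).image _) ?_
        rintro _ ⟨x, hx, rfl⟩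
        have := hlow x hx
        rw [le_div_iff₀ (by linarith), ← sub_le_iff_le_add, le_div_iff₀ hKpos]
        change K * _ ≤ E at this
        dsimp only
        linarith
      rw [le_div_iff₀ (by linarith)] at hsup
      have : 1 ≤ E / K := by linarith
      rwa [le_div_iff₀ hKpos, one_mul] at this
end

section
/- (Talenti's inequality) Let p > N. For every smooth function u with compact support contained in Ω, N ω_N^{p/N} ((p−N)/(p−1))^{p−1} |Ω|^{1−p/N} (sup_{x∈Ω} |u(x)|)^p ≤ ∫_Ω ‖∇u(x)‖^p dx. -/
open MeasureTheory Filter Topology Metric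

open scoped ENNReal

theorem aux_polar_s5 {N : ℕ} (hN : 2 ≤ N) (f : EuclideanSpace ℝ (Fin N) → ℝ≥0∞) (hf : Measurable f) :
    ∫⁻ x, f x = ∫⁻ θ : sphere (0 : EuclideanSpace ℝ (Fin N)) 1, (∫⁻ r in Set.Ioi (0:ℝ),
      ENNReal.ofReal (r ^ (N - 1)) * f (r • (θ : EuclideanSpace ℝ (Fin N))))
        ∂((volume : Measure (EuclideanSpace ℝ (Fin N))).toSphere) := by
  have h1 : ∫⁻ x, f x = ∫⁻ x : ({(0)}ᶜ : Set (EuclideanSpace ℝ (Fin N))), f x.1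
      ∂((volume : Measure (EuclideanSpace ℝ (Fin N))).comap (↑)) := by
    have : Nontrivial (EuclideanSpace ℝ (Fin N)) := by
      have : Nonempty (Fin N) := ⟨⟨0, by omega⟩⟩
      infer_instance
    rw [lintegral_subtype_comap (measurableSet_singleton _).compl, restrict_compl_singleton]
  have h2 := (volume : Measure (EuclideanSpace ℝ (Fin N))).measurePreserving_homeomorphUnitSphereProd.lintegral_comp_emb
        (Homeomorph.measurableEmbedding _) (fun z => f (z.2.1 • z.1.1))
  have h3 : ∀ x : ({(0)}ᶜ : Set (EuclideanSpace ℝ (Fin N))),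
     ((homeomorphUnitSphereProd _ x).2.1 • (homeomorphUnitSphereProd _ x).1.1) = x.1 := by
    intro x
    have := (homeomorphUnitSphereProd _).symm_apply_apply x
    have h := congrArg Subtype.val this
    rw [homeomorphUnitSphereProd_symm_apply_coe] at h
    exact h
  simp only [h3] at h2
  rw [h1, h2, lintegral_prod]
  · refine lintegral_congr fun θ => ?_
    rw [Measure.volumeIoiPow, lintegral_withDensity_eq_lintegral_mul₀]
    · simp only [Pi.mul_apply, finrank_euclideanSpace, Fintype.card_fin]
      exact lintegral_subtype_comap (μ := volume) measurableSet_Ioi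
       (fun r : ℝ => ENNReal.ofReal (r ^ (N - 1)) * f (r • (θ : EuclideanSpace ℝ (Fin N))))
    · fun_prop
    · exact (hf.comp (by fun_prop)).aemeasurable
  · refine (hf.comp ?_).aemeasurable
    fun_prop

theorem aux_ray_s5 {E : Type*} [NormedAddCommGroup E] [NormedSpace ℝ E] (u : E → ℝ) (hu : ContDiff ℝ 1 u) (hus : HasCompactSupport u) (θ : E) (hθ : ‖θ‖ = 1) :
    ‖u 0‖ₑ ≤ ∫⁻ r in Set.Ioi (0:ℝ), ‖fderiv ℝ u (r • θ)‖ₑ := by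
  have hc : ContDiff ℝ 1 (fun t : ℝ => u ((-t) • θ)) := hu.comp (by fun_prop)
  have hemb : Topology.IsClosedEmbedding (fun t : ℝ => (-t) • θ) := by
    refine Isometry.isClosedEmbedding (Isometry.of_dist_eq fun x y => ?_)
    rw [dist_eq_norm, ← sub_smul, norm_smul, hθ, Real.dist_eq, mul_one, Real.norm_eq_abs, abs_sub_comm]
    congr 1; ring
  have h := HasCompactSupport.enorm_le_lintegral_Ici_deriv hc (hus.comp_isClosedEmbedding hemb) 0
  simp only [neg_zero, zero_smul] at h
  refine h.trans ?_
  have hd : ∀ t : ℝ, ‖deriv (fun t : ℝ => u ((-t) • θ)) t‖ₑ ≤ ‖fderiv ℝ u ((-t) • θ)‖ₑ := by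
    intro t
    have h1 : HasDerivAt (fun t : ℝ => (-t) • θ) ((-1 : ℝ) • θ) t :=
      (hasDerivAt_neg t).smul_const θ
    have h2 := ((hu.differentiable (by simp)) ((-t) • θ)).hasFDerivAt.comp_hasDerivAt t h1
    rw [show (fun t : ℝ => u ((-t) • θ)) = u ∘ (fun t : ℝ => (-t) • θ) from rfl, h2.deriv]
    rw [← ofReal_norm, ← ofReal_norm]
    refine ENNReal.ofReal_le_ofReal ?_
    refine (ContinuousLinearMap.le_opNorm _ _).trans ?_
    simp [norm_smul, hθ]
  refine (lintegral_mono hd).trans ?_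
  have := (Measure.measurePreserving_neg (volume : Measure ℝ)).setLIntegral_comp_preimage_emb
    (MeasurableEquiv.neg ℝ).measurableEmbedding (fun r : ℝ => ‖fderiv ℝ u (r • θ)‖ₑ) (Set.Ici 0)
  simp only [Set.neg_preimage, Set.neg_Ici, neg_zero] at this
  rw [this, setLIntegral_congr Ioi_ae_eq_Ici]

theorem aux_pot {N : ℕ} (hN : 2 ≤ N) (u : EuclideanSpace ℝ (Fin N) → ℝ) (hu : ContDiff ℝ 1 u) (hus : HasCompactSupport u) :
    ENNReal.ofReal (N * (volume (ball (0 : EuclideanSpace ℝ (Fin N)) 1)).toReal) * ‖u 0‖ₑ ≤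
      ∫⁻ x, ‖fderiv ℝ u x‖ₑ * ENNReal.ofReal (‖x‖ ^ (1 - N : ℝ)) := by
  have hcont : Continuous (fderiv ℝ u) := hu.continuous_fderiv (by simp)
  rw [aux_polar_s5 hN]
  swap
  · exact (hcont.enorm.measurable).mul (by fun_prop)
  calc _ = ∫⁻ θ : sphere (0 : EuclideanSpace ℝ (Fin N)) 1, ‖u 0‖ₑ
        ∂((volume : Measure (EuclideanSpace ℝ (Fin N))).toSphere) := by
        rw [lintegral_const, Measure.toSphere_apply_univ, mul_comm, ENNReal.ofReal_mul (by positivity),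
          ENNReal.ofReal_toReal measure_ball_lt_top.ne]
        simp
    _ ≤ _ := by
      refine lintegral_mono fun θ => ?_
      have hθ : ‖(θ : EuclideanSpace ℝ (Fin N))‖ = 1 := by simpa using θ.2
      refine (aux_ray_s5 u hu hus θ hθ).trans (le_of_eq ?_)
      refine setLIntegral_congr_fun measurableSet_Ioi fun r hr => ?_
      have hr : 0 < r := hr
      simp only [norm_smul, hθ, Real.norm_eq_abs, abs_of_pos hr, mul_one]
      rw [mul_left_comm, ← ENNReal.ofReal_mul (by positivity), ← Real.rpow_natCast, ← Real.rpow_add hr,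
        Nat.cast_sub (by omega)]
      simp

theorem aux_ball {N : ℕ} (hN : 2 ≤ N) (a R : ℝ) (ha : a < N) (hR : 0 < R) :
    ∫⁻ x in ball (0 : EuclideanSpace ℝ (Fin N)) R, ENNReal.ofReal (‖x‖ ^ (-a)) =
      ENNReal.ofReal (N * (volume (ball (0 : EuclideanSpace ℝ (Fin N)) 1)).toReal * (R ^ (N - a) / (N - a))) := by
  rw [← lintegral_indicator measurableSet_ball, aux_polar_s5 hN]
  swap
  · exact Measurable.indicator (by fun_prop) measurableSet_ball
  have key : ∀ θ : sphere (0 : EuclideanSpace ℝ (Fin N)) 1, (∫⁻ r in Set.Ioi (0:ℝ),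
      ENNReal.ofReal (r ^ (N - 1)) * (ball (0 : EuclideanSpace ℝ (Fin N)) R).indicator (fun x => ENNReal.ofReal (‖x‖ ^ (-a))) (r • (θ : EuclideanSpace ℝ (Fin N)))) = ENNReal.ofReal (R ^ (N - a) / (N - a)) := by
    intro θ
    have hθ : ‖(θ : EuclideanSpace ℝ (Fin N))‖ = 1 := by simpa using θ.2
    have e1 : ∫⁻ r in Set.Ioi (0:ℝ),
      ENNReal.ofReal (r ^ (N - 1)) * (ball (0 : EuclideanSpace ℝ (Fin N)) R).indicator (fun x => ENNReal.ofReal (‖x‖ ^ (-a))) (r • (θ : EuclideanSpace ℝ (Fin N))) = ∫⁻ r in Set.Ioi (0:ℝ), (Set.Iio R).indicator (fun r => ENNReal.ofReal (r ^ (N - 1 - a))) r := by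
      refine setLIntegral_congr_fun measurableSet_Ioi fun r hr => ?_
      have hr : 0 < r := hr
      simp only [Set.indicator, mem_ball_zero_iff, norm_smul, hθ, Real.norm_eq_abs, abs_of_pos hr, mul_one, Set.mem_Iio]
      split_ifs
      · rw [← ENNReal.ofReal_mul (by positivity), ← Real.rpow_natCast, ← Real.rpow_add hr,
        Nat.cast_sub (by omega)]
        simp [sub_eq_add_neg]
      · simp
    have hab : (-1 : ℝ) < N - 1 - a := by linarith
    rw [e1, setLIntegral_indicator measurableSet_Iio, Set.inter_comm, Set.Ioi_inter_Iio,
      ← ofReal_integral_eq_lintegral_ofReal]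
    · rw [← integral_Ioc_eq_integral_Ioo, ← intervalIntegral.integral_of_le hR.le, integral_rpow (Or.inl hab)]
      rw [Real.zero_rpow (by linarith)]
      congr 1; ring_nf
    · exact (intervalIntegral.integrableOn_Ioo_rpow_iff hR).2 hab
    · filter_upwards [ae_restrict_mem measurableSet_Ioo] with r hr
      exact Real.rpow_nonneg hr.1.le _
  simp only [key]
  rw [lintegral_const, Measure.toSphere_apply_univ, mul_comm, ENNReal.ofReal_mul (by positivity), ENNReal.ofReal_mul (by positivity),
          ENNReal.ofReal_toReal measure_ball_lt_top.ne]
  simp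

theorem aux_rearr_s5 {N : ℕ} (hN : 2 ≤ N) (Ω : Set (EuclideanSpace ℝ (Fin N))) (hΩ : MeasurableSet Ω)
    (a R : ℝ) (ha : 0 ≤ a) (hR : 0 < R) (hV : volume Ω = volume (ball (0 : EuclideanSpace ℝ (Fin N)) R)) :
    ∫⁻ x in Ω, ENNReal.ofReal (‖x‖ ^ (-a)) ≤
    ∫⁻ x in ball (0 : EuclideanSpace ℝ (Fin N)) R, ENNReal.ofReal (‖x‖ ^ (-a)) := by
  set B := ball (0 : EuclideanSpace ℝ (Fin N)) R
  have hB : MeasurableSet B := measurableSet_ball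
  have hBf : volume B ≠ ∞ := measure_ball_lt_top.ne
  have hd : volume (Ω \ B) = volume (B \ Ω) := by
    have h1 := measure_inter_add_sdiff (μ := volume) Ω hB
    have h2 := measure_inter_add_sdiff (μ := volume) B hΩ
    rw [Set.inter_comm] at h2
    rw [hV, ← h2] at h1
    exact (ENNReal.add_right_inj (measure_ne_top_of_subset Set.inter_subset_right hBf)).1 h1
  rw [← lintegral_inter_add_sdiff _ Ω hB, ← lintegral_inter_add_sdiff _ B hΩ, Set.inter_comm B Ω]
  gcongr 1
  calc ∫⁻ x in Ω \ B, ENNReal.ofReal (‖x‖ ^ (-a)) ≤ ∫⁻ x in Ω \ B, ENNReal.ofReal (R ^ (-a)) := by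
        refine setLIntegral_mono (by fun_prop) fun x hx => ENNReal.ofReal_le_ofReal ?_
        have : R ≤ ‖x‖ := by simpa [B] using hx.2
        exact Real.rpow_le_rpow_of_nonpos hR this (by linarith)
    _ = ∫⁻ x in B \ Ω, ENNReal.ofReal (R ^ (-a)) := by simp [hd]
    _ ≤ ∫⁻ x in B \ Ω, ENNReal.ofReal (‖x‖ ^ (-a)) := by
        have : Nontrivial (EuclideanSpace ℝ (Fin N)) := by
          have : Nonempty (Fin N) := ⟨⟨0, by omega⟩⟩
          infer_instance
        have h0 : ∀ᵐ x : EuclideanSpace ℝ (Fin N), x ≠ 0 := by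
          simp [ae_iff]
        refine setLIntegral_mono_ae (by fun_prop) ?_
        filter_upwards [h0] with x hx0 hx
        refine ENNReal.ofReal_le_ofReal ?_
        have : ‖x‖ < R := by simpa [B] using hx.1
        exact Real.rpow_le_rpow_of_nonpos (norm_pos_iff.2 hx0) this.le (by linarith)

theorem aux_core {N : ℕ} (hN : 2 ≤ N) (Ω : Set (EuclideanSpace ℝ (Fin N)))
    (hΩo : IsOpen Ω) (hΩb : Bornology.IsBounded Ω) (hΩne : Ω.Nonempty)
    (p : ℝ) (hp : (N : ℝ) < p)
    (u : EuclideanSpace ℝ (Fin N) → ℝ)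
    (hu : ContDiff ℝ 1 u) (hus : HasCompactSupport u) (huΩ : tsupport u ⊆ Ω) :
    ENNReal.ofReal (N * (volume (ball (0 : EuclideanSpace ℝ (Fin N)) 1)).toReal ^ (p / N) *
        ((p - N) / (p - 1)) ^ (p - 1) * (volume Ω).toReal ^ (1 - p / N) *
        |u 0| ^ p) ≤
      ∫⁻ x in Ω, ‖fderiv ℝ u x‖ₑ ^ p := by
  have hN' : (2:ℝ) ≤ N := by exact_mod_cast hN
  have hp0 : 0 < p := by linarith
  have : Nontrivial (EuclideanSpace ℝ (Fin N)) := by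
    have : Nonempty (Fin N) := ⟨⟨0, by omega⟩⟩
    infer_instance
  set D := ∫⁻ x in Ω, ‖fderiv ℝ u x‖ₑ ^ p with hD
  set ω := (volume (ball (0 : EuclideanSpace ℝ (Fin N)) 1)).toReal with hω
  set V := (volume Ω).toReal with hVd
  have hcont : Continuous (fderiv ℝ u) := hu.continuous_fderiv (by simp)
  have hω0 : 0 < ω := ENNReal.toReal_pos (measure_ball_pos _ _ one_pos).ne' measure_ball_lt_top.ne
  have hV0 : 0 < V := ENNReal.toReal_pos (hΩo.measure_pos _ hΩne).ne' hΩb.measure_lt_top.ne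
  by_cases hDt : D = ∞
  · rw [hDt]; exact le_top
  set R := (V / ω) ^ (1 / N : ℝ) with hR
  have hR0 : 0 < R := by positivity
  have hRN : R ^ N * ω = V := by
    rw [hR, ← Real.rpow_natCast, ← Real.rpow_mul (by positivity), one_div_mul_cancel (by positivity), Real.rpow_one]
    field_simp
  have hVB : volume Ω = volume (ball (0 : EuclideanSpace ℝ (Fin N)) R) := by
    rw [Measure.addHaar_ball _ _ hR0.le, ← ENNReal.ofReal_toReal hΩb.measure_lt_top.ne, ← hVd, ← hRN,
      ENNReal.ofReal_mul (by positivity), hω, ENNReal.ofReal_toReal measure_ball_lt_top.ne]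
    simp
  have hpq : p.HolderConjugate (p / (p - 1)) := Real.HolderConjugate.conjExponent (by linarith)
  set q := p / (p - 1) with hq
  set s := (p - N) / (p - 1) with hs
  have hp1 : 0 < p - 1 := by linarith
  have hq0 : 0 < q := div_pos hp0 hp1
  have hs0 : 0 < s := div_pos (by linarith) hp1
  have hJ : ∫⁻ x in Ω, (ENNReal.ofReal (‖x‖ ^ (1 - N : ℝ))) ^ q ≤ ENNReal.ofReal (N * ω * (R ^ s / s)) := by
    have e : ∀ x : EuclideanSpace ℝ (Fin N), (ENNReal.ofReal (‖x‖ ^ (1 - N : ℝ))) ^ q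
       = ENNReal.ofReal (‖x‖ ^ (-((N - 1) * q))) := by
      intro x
      rw [ENNReal.ofReal_rpow_of_nonneg (by positivity) (by positivity), ← Real.rpow_mul (by positivity)]
      congr 2; ring
    simp only [e]
    have es : (N : ℝ) - (N - 1) * q = s := by
      rw [hq, hs]; field_simp; ring
    refine (aux_rearr_s5 hN Ω hΩo.measurableSet ((N - 1) * q) R (mul_nonneg (by linarith) (by positivity)) hR0 hVB).trans ?_
    rw [aux_ball hN _ _ (by linarith) hR0, es]
  have hpot := aux_pot hN u hu hus
  rw [← hω] at hpot
  have hsupp : ∫⁻ x, ‖fderiv ℝ u x‖ₑ * ENNReal.ofReal (‖x‖ ^ (1 - N : ℝ)) =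
     ∫⁻ x in Ω, ‖fderiv ℝ u x‖ₑ * ENNReal.ofReal (‖x‖ ^ (1 - N : ℝ)) := by
    rw [← lintegral_indicator hΩo.measurableSet]
    refine lintegral_congr fun x => ?_
    by_cases hx : x ∈ Ω
    · simp [hx]
    · have : fderiv ℝ u x = 0 := by
        by_contra h
        exact hx (huΩ (support_fderiv_subset ℝ h))
      have h0 : ‖fderiv ℝ u x‖ₑ = 0 := by
        rw [← ofReal_norm, this, norm_zero, ENNReal.ofReal_zero]
      rw [h0, zero_mul, Set.indicator_of_notMem hx]
  rw [hsupp] at hpot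
  have hH := ENNReal.lintegral_mul_le_Lp_mul_Lq (volume.restrict Ω) hpq
    (f := fun x => ‖fderiv ℝ u x‖ₑ) (g := fun x : EuclideanSpace ℝ (Fin N) => ENNReal.ofReal (‖x‖ ^ (1 - N : ℝ)))
    hcont.enorm.measurable.aemeasurable (by fun_prop)
  simp only [Pi.mul_apply] at hH
  have hmain := hpot.trans (hH.trans (mul_le_mul_right (ENNReal.rpow_le_rpow hJ (by positivity : 0 ≤ 1 / q)) _))
  rw [← hD] at hmain
  have hDr : D = ENNReal.ofReal D.toReal := (ENNReal.ofReal_toReal hDt).symm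
  have hd0 : 0 ≤ D.toReal := ENNReal.toReal_nonneg
  set d := D.toReal with hd
  rw [hDr, ← ofReal_norm, ENNReal.ofReal_rpow_of_nonneg hd0 (by positivity), ENNReal.ofReal_rpow_of_nonneg (by positivity) (by positivity),
    ← ENNReal.ofReal_mul (by positivity), ← ENNReal.ofReal_mul (by positivity), ENNReal.ofReal_le_ofReal_iff (by positivity), Real.norm_eq_abs] at hmain
  rw [hDr]
  refine ENNReal.ofReal_le_ofReal ?_
  have hpow := Real.rpow_le_rpow (by positivity) hmain (by linarith : 0 ≤ p)
  have hpq1 : 1 / q * p = p - 1 := by rw [hq]; field_simp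
  rw [Real.mul_rpow (x := N * ω) (by positivity) (by positivity), Real.mul_rpow (x := d ^ (1 / p)) (by positivity) (by positivity),
    ← Real.rpow_mul hd0, ← Real.rpow_mul (by positivity), hpq1, one_div_mul_cancel (by linarith), Real.rpow_one,
    Real.mul_rpow (x := N * ω) (by positivity) (by positivity), Real.div_rpow (by positivity) (by positivity), ← Real.rpow_mul hR0.le] at hpow
  have hsp : s * (p - 1) = p - N := by rw [hs]; field_simp
  rw [hsp] at hpow
  have hRp : R ^ (p - N) = V ^ (p / N - 1) / ω ^ (p / N - 1) := by
    rw [hR, ← Real.rpow_mul (by positivity), ← Real.div_rpow (by positivity) (by positivity)]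
    congr 1; field_simp
  have e1 : (N * ω) ^ p = (N * ω) ^ (p - 1) * (N * ω) := by
    rw [Real.rpow_sub_one (by positivity)]; field_simp
  have e2 : ω ^ (p / N) = ω ^ (p / N - 1) * ω := by
    rw [Real.rpow_sub_one (by positivity)]; field_simp
  have e3 : V ^ (1 - p / N) = (V ^ (p / N - 1))⁻¹ := by
    rw [← Real.rpow_neg hV0.le]; congr 1; ring
  rw [hRp, e1] at hpow
  rw [e2, e3]
  have hA : 0 < (N * ω) ^ (p - 1) := by positivity
  have hB : 0 < ω ^ (p / N - 1) := by positivity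
  have hC : 0 < V ^ (p / N - 1) := by positivity
  have hS : 0 < s ^ (p - 1) := by positivity
  generalize (N * ω) ^ (p - 1) = A at *
  generalize ω ^ (p / N - 1) = B at *
  generalize V ^ (p / N - 1) = C at *
  generalize s ^ (p - 1) = S at *
  have h4 : A * (N * ω * |u 0| ^ p) ≤ A * (d * (C / B / S)) := by linarith
  have h5 := le_of_mul_le_mul_left h4 hA
  calc N * (B * ω) * S * C⁻¹ * |u 0| ^ p = (N * ω * |u 0| ^ p) * (B * S / C) := by field_simp
    _ ≤ (d * (C / B / S)) * (B * S / C) := by gcongr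
    _ = d := by field_simp

theorem aux_pt {N : ℕ} (hN : 2 ≤ N) (Ω : Set (EuclideanSpace ℝ (Fin N)))
    (hΩo : IsOpen Ω) (hΩb : Bornology.IsBounded Ω) (hΩne : Ω.Nonempty)
    (p : ℝ) (hp : (N : ℝ) < p)
    (u : EuclideanSpace ℝ (Fin N) → ℝ)
    (hu : ContDiff ℝ 1 u) (hus : HasCompactSupport u) (huΩ : tsupport u ⊆ Ω)
    (x₀ : EuclideanSpace ℝ (Fin N)) :
    ENNReal.ofReal (N * (volume (ball (0 : EuclideanSpace ℝ (Fin N)) 1)).toReal ^ (p / N) *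
        ((p - N) / (p - 1)) ^ (p - 1) * (volume Ω).toReal ^ (1 - p / N) *
        |u x₀| ^ p) ≤
      ∫⁻ x in Ω, ‖fderiv ℝ u x‖ₑ ^ p := by
  have hmp := measurePreserving_add_left (volume : Measure (EuclideanSpace ℝ (Fin N))) x₀
  let T := Homeomorph.addLeft x₀
  have h := aux_core hN (T ⁻¹' Ω) (hΩo.preimage T.continuous) ?_ (hΩne.preimage T.surjective) p hp
    (u ∘ T) (hu.comp (by change ContDiff ℝ 1 (fun x => x₀ + x); fun_prop)) (hus.comp_homeomorph T) ?_
  · have e1 : volume (T ⁻¹' Ω) = volume Ω := hmp.measure_preimage hΩo.measurableSet.nullMeasurableSet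
    have e2 : (u ∘ T) 0 = u x₀ := by simp [T]
    have e3 : ∀ x, fderiv ℝ (u ∘ T) x = fderiv ℝ u (x₀ + x) := by
      intro x
      exact fderiv_comp_add_left x₀
    simp only [e1, e2, e3] at h
    refine h.trans (le_of_eq ?_)
    exact hmp.setLIntegral_comp_preimage_emb T.measurableEmbedding (fun x => ‖fderiv ℝ u x‖ₑ ^ p) Ω
  · have : T ⁻¹' Ω = (fun y => -x₀ + y) '' Ω := by
      ext y; simp [T]
    rw [this]
    exact (LipschitzWith.of_dist_le_mul (K := 1) (by simp)).isBounded_image hΩb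
  · rw [tsupport_comp_eq_preimage]
    exact Set.preimage_mono huΩ

theorem stmt5 {N : ℕ} (hN : 2 ≤ N) (Ω : Set (EuclideanSpace ℝ (Fin N)))
    (hΩo : IsOpen Ω) (hΩb : Bornology.IsBounded Ω) (hΩne : Ω.Nonempty)
    (p : ℝ) (hp : (N : ℝ) < p)
    (u : EuclideanSpace ℝ (Fin N) → ℝ)
    (hu : ContDiff ℝ (⊤ : ℕ∞) u) (hus : HasCompactSupport u) (huΩ : tsupport u ⊆ Ω) :
    N * (volume (ball (0 : EuclideanSpace ℝ (Fin N)) 1)).toReal ^ (p / N) *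
        ((p - N) / (p - 1)) ^ (p - 1) * (volume Ω).toReal ^ (1 - p / N) *
        (sSup ((fun x => |u x|) '' Ω)) ^ p ≤
      ∫ x in Ω, ‖gradient u x‖ ^ p := by
  have hu1 : ContDiff ℝ 1 u := hu.of_le (by exact_mod_cast le_top)
  have hcont : Continuous (fderiv ℝ u) := hu1.continuous_fderiv (by simp)
  have hN' : (2:ℝ) ≤ N := by exact_mod_cast hN
  have hp0 : 0 < p := by linarith
  have hg : ∀ x, ‖gradient u x‖ = ‖fderiv ℝ u x‖ := by
    intro x
    rw [← toDual_gradient, LinearIsometryEquiv.norm_map]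
  simp only [hg]
  have hI : Integrable (fun x => ‖fderiv ℝ u x‖ ^ p) := by
    refine Continuous.integrable_of_hasCompactSupport (hcont.norm.rpow_const fun x => Or.inr hp0.le) ?_
    exact (hus.fderiv ℝ).comp_left (g := fun L => ‖L‖ ^ p) (by simp [hp0.ne'])
  set I := ∫ x in Ω, ‖fderiv ℝ u x‖ ^ p with hId
  have hI0 : 0 ≤ I := integral_nonneg fun x => by positivity
  have hlI : ∫⁻ x in Ω, ‖fderiv ℝ u x‖ₑ ^ p = ENNReal.ofReal I := by
    rw [hId, ofReal_integral_eq_lintegral_ofReal hI.integrableOn (ae_of_all _ fun x => by positivity)]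
    refine lintegral_congr fun x => ?_
    rw [← ofReal_norm, ENNReal.ofReal_rpow_of_nonneg (by positivity) hp0.le]
  have hω0 : 0 < (volume (ball (0 : EuclideanSpace ℝ (Fin N)) 1)).toReal :=
    ENNReal.toReal_pos (measure_ball_pos _ _ one_pos).ne' measure_ball_lt_top.ne
  have hV0 : 0 < (volume Ω).toReal :=
    ENNReal.toReal_pos (hΩo.measure_pos _ hΩne).ne' hΩb.measure_lt_top.ne
  have hs0 : 0 < (p - N) / (p - 1) := div_pos (by linarith) (by linarith)
  have hpt := fun x => aux_pt hN Ω hΩo hΩb hΩne p hp u hu1 hus huΩ x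
  simp only [hlI, ENNReal.ofReal_le_ofReal_iff hI0] at hpt
  have hK : 0 < N * (volume (ball (0 : EuclideanSpace ℝ (Fin N)) 1)).toReal ^ (p / N) *
        ((p - N) / (p - 1)) ^ (p - 1) * (volume Ω).toReal ^ (1 - p / N) := by positivity
  set K := N * (volume (ball (0 : EuclideanSpace ℝ (Fin N)) 1)).toReal ^ (p / N) *
        ((p - N) / (p - 1)) ^ (p - 1) * (volume Ω).toReal ^ (1 - p / N)
  have hsup : sSup ((fun x => |u x|) '' Ω) ≤ (I / K) ^ (1 / p) := by
    refine csSup_le (hΩne.image _) ?_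
    rintro _ ⟨x, -, rfl⟩
    have h1 : |u x| ^ p ≤ I / K := by
      rw [le_div_iff₀ hK, mul_comm]; exact hpt x
    have h2 := Real.rpow_le_rpow (by positivity) h1 (by positivity : 0 ≤ 1 / p)
    rwa [← Real.rpow_mul (by positivity), mul_one_div_cancel hp0.ne', Real.rpow_one] at h2
  have hsup0 : 0 ≤ sSup ((fun x => |u x|) '' Ω) := by
    refine Real.sSup_nonneg ?_
    rintro _ ⟨x, -, rfl⟩
    exact abs_nonneg _
  have h3 := Real.rpow_le_rpow hsup0 hsup hp0.le
  rw [← Real.rpow_mul (by positivity), one_div_mul_cancel hp0.ne', Real.rpow_one, le_div_iff₀ hK, mul_comm] at h3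
  exact h3
end

section
/- Let Ω be a nonempty bounded open connected subset of ℝ^N and let p > N. Then Λ_p(Ω) = N ω_N^{p/N} ((p−N)/(p−1))^{p−1} |Ω|^{1−p/N} if and only if Ω is an open Euclidean ball, i.e., there exist x₀ ∈ ℝ^N and r > 0 with Ω = B_r(x₀). In particular, if Ω is not a ball then Talenti's inequality N ω_N^{p/N} ((p−N)/(p−1))^{p−1} |Ω|^{1−p/N} (sup_Ω |u|)^p ≤ ∫_Ω ‖∇u‖^p dx is strict for every nonzero admissible u. -/
open MeasureTheory Filter Topology Metric

abbrev EE (N : ℕ) := EuclideanSpace ℝ (Fin N)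

noncomputable def kf {N : ℕ} (v : EE N) : EE N := (‖v‖ ^ N)⁻¹ • v

lemma polar_int {N : ℕ} (hN : 2 ≤ N) (f : EE N → ℝ) (hf : Integrable f) :
    ∫ x, f x = ∫ w : sphere (0 : EE N) 1,
      (∫ r in Set.Ioi (0 : ℝ), r ^ (N - 1) * f (r • (w : EE N))) ∂(volume : Measure (EE N)).toSphere := by
  have hfin : Module.finrank ℝ (EE N) = N := by simp
  have : Nontrivial (EE N) := by
    apply Module.nontrivial_of_finrank_pos (R := ℝ); omega
  set μ : Measure (EE N) := volume
  have hmp := μ.measurePreserving_homeomorphUnitSphereProd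
  rw [hfin] at hmp
  set g : sphere (0 : EE N) 1 × Set.Ioi (0 : ℝ) → ℝ := fun x => f (x.2.1 • (x.1 : EE N))
  have hg : ∀ x : ({(0)}ᶜ : Set (EE N)), g (homeomorphUnitSphereProd (EE N) x) = f x.1 := by
    intro x
    have : ‖(x : EE N)‖ ≠ 0 := norm_ne_zero_iff.2 x.2
    simp [g, smul_smul, this]
  have hgi : Integrable g (μ.toSphere.prod (.volumeIoiPow (N - 1))) := by
    rw [← hmp.integrable_comp_emb (Homeomorph.measurableEmbedding _)]
    have : g ∘ (homeomorphUnitSphereProd (EE N)) = f ∘ (Subtype.val) := by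
      ext x; exact hg x
    rw [this, ← integrableOn_iff_comap_subtypeVal (measurableSet_singleton _).compl]
    exact hf.integrableOn
  calc ∫ x, f x ∂μ = ∫ x : ({(0)}ᶜ : Set (EE N)), f x.1 ∂(μ.comap (↑)) := by
        rw [integral_subtype_comap (measurableSet_singleton _).compl fun x ↦ f x,
          restrict_compl_singleton]
    _ = ∫ x, g x ∂μ.toSphere.prod (.volumeIoiPow (N - 1)) := by
        rw [← hmp.integral_comp (Homeomorph.measurableEmbedding _)]
        simp_rw [hg]
    _ = ∫ w, ∫ r, g (w, r) ∂(.volumeIoiPow (N - 1)) ∂μ.toSphere := integral_prod _ hgi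
    _ = _ := by
        congr 1
        ext w
        simp only [Measure.volumeIoiPow, ENNReal.ofReal]
        rw [integral_withDensity_eq_integral_smul]
        · simp only [g]
          rw [integral_subtype_comap measurableSet_Ioi fun a ↦ Real.toNNReal (a ^ (N - 1)) • f (a • (w : EE N))]
          refine setIntegral_congr_fun measurableSet_Ioi fun x hx ↦ ?_
          rw [NNReal.smul_def, Real.coe_toNNReal _ (pow_nonneg hx.out.le _), smul_eq_mul]
        · exact (measurable_subtype_coe.pow_const _).real_toNNReal

lemma kf_norm {N : ℕ} (hN : 2 ≤ N) (v : EE N) : ‖kf v‖ = ‖v‖ ^ (-((N : ℝ) - 1)) := by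
  have hN' : (2 : ℝ) ≤ N := by exact_mod_cast hN
  rcases eq_or_ne v 0 with rfl | h
  · simp only [kf, smul_zero, norm_zero]
    rw [Real.zero_rpow]; linarith
  · have h' : 0 < ‖v‖ := norm_pos_iff.2 h
    rw [kf, norm_smul, norm_inv, norm_pow, norm_norm, neg_sub, Real.rpow_sub h', Real.rpow_one,
      Real.rpow_natCast]
    field_simp

lemma kf_meas {N : ℕ} : Measurable (kf : EE N → EE N) := by
  unfold kf; fun_prop

lemma kf_integrableOn {N : ℕ} (hN : 2 ≤ N) (L : ℝ) : IntegrableOn (kf : EE N → EE N) (ball 0 L) := by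
  have hfin : Module.finrank ℝ (EE N) = N := by simp
  refine integrableOn_ball_of_norm_le_rpow (C := 1) (α := (N:ℝ) - 1) (by omega) (by rw [hfin]; linarith) ?_ kf_meas.aestronglyMeasurable
  filter_upwards with x
  rw [kf_norm hN, one_mul]

lemma grad_cont {N : ℕ} {u : EE N → ℝ} (hu : ContDiff ℝ (⊤ : ℕ∞) u) : Continuous (gradient u) := by
  unfold gradient
  exact (LinearIsometryEquiv.continuous _).comp (hu.continuous_fderiv (by simp))

lemma grad_supp {N : ℕ} {u : EE N → ℝ} : tsupport (gradient u) ⊆ tsupport u := by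
  refine closure_minimal ?_ (isClosed_tsupport u)
  intro x hx
  refine support_fderiv_subset ℝ (f := u) ?_
  intro h
  apply hx
  simp [gradient, h]

lemma grad_cs {N : ℕ} {u : EE N → ℝ} (hc : HasCompactSupport u) : HasCompactSupport (gradient u) :=
  hc.of_isClosed_subset (isClosed_tsupport _) grad_supp

lemma rep_cone {N : ℕ} (hN : 2 ≤ N) {u : EE N → ℝ} (hu : ContDiff ℝ (⊤ : ℕ∞) u)
    (hc : HasCompactSupport u) (z : EE N) (s : Set (EE N)) (hs : MeasurableSet s)
    (hcone : ∀ r : ℝ, 0 < r → ∀ w, r • w ∈ s ↔ w ∈ s) :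
    ∫ y, inner ℝ (gradient u (z + y)) (s.indicator kf y) =
      -u z * (volume : Measure (EE N)).toSphere.real {w | (w : EE N) ∈ s} := by
  have hN1 : N - 1 + 1 = N := by omega
  have hgc := grad_cont hu
  have hgs := grad_cs hc
  have hint : Integrable (fun y => inner ℝ (gradient u (z + y)) (s.indicator kf y)) := by
    obtain ⟨C, hC⟩ := hgs.exists_bound_of_continuous hgc
    obtain ⟨L, hL⟩ := (hgs.isBounded).subset_ball 0
    have hm : Measurable (fun y => inner ℝ (gradient u (z + y)) (s.indicator kf y)) := by
      have h1 : Measurable (fun y => gradient u (z + y)) := (hgc.comp (by fun_prop)).measurable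
      exact h1.inner (kf_meas.indicator hs)
    have hI : Integrable ((ball (0 : EE N) (L + ‖z‖)).indicator (fun y => C * ‖kf y‖)) := by
      rw [integrable_indicator_iff measurableSet_ball]
      exact ((kf_integrableOn hN _).norm.const_mul C)
    refine hI.mono' hm.aestronglyMeasurable ?_
    filter_upwards with y
    by_cases hy : y ∈ ball (0 : EE N) (L + ‖z‖)
    · rw [Set.indicator_of_mem hy]
      refine (norm_inner_le_norm _ _).trans ?_
      gcongr
      · exact (norm_nonneg _).trans (hC 0)
      · exact hC _
      · exact norm_indicator_le_norm_self _ _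
    · rw [Set.indicator_of_notMem hy]
      have : gradient u (z + y) = 0 := by
        by_contra h
        have h2 := hL (subset_tsupport _ h)
        simp only [mem_ball, dist_zero_right] at h2 hy
        have : ‖y‖ ≤ ‖z + y‖ + ‖z‖ := by
          have := norm_sub_le (z + y) z
          simpa using this
        linarith
      simp [this]
  rw [polar_int hN _ hint]
  have key : ∀ w : sphere (0 : EE N) 1, (∫ r in Set.Ioi (0 : ℝ), r ^ (N - 1) *
      inner ℝ (gradient u (z + r • (w : EE N))) (s.indicator kf (r • (w : EE N)))) =
      Set.indicator {w : sphere (0 : EE N) 1 | (w : EE N) ∈ s} (fun _ => - u z) w := by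
    intro w
    have hw : ‖(w : EE N)‖ = 1 := by simpa using w.2
    by_cases hws : (w : EE N) ∈ s
    · rw [Set.indicator_of_mem (by exact hws)]
      have hd : ∀ r : ℝ, HasDerivAt (fun r : ℝ => u (z + r • (w : EE N)))
          (inner ℝ (gradient u (z + r • (w : EE N))) (w : EE N)) r := by
        intro r
        rw [inner_gradient_left]
        have h1 : HasDerivAt (fun r : ℝ => z + r • (w : EE N)) (w : EE N) r := by
          simpa using ((hasDerivAt_id r).smul_const (w : EE N)).const_add z
        exact ((hu.differentiable (by simp) (z + r • (w : EE N))).hasFDerivAt).comp_hasDerivAt r h1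
      have hcd : ContDiff ℝ 1 (fun r : ℝ => u (z + r • (w : EE N))) := by
        have : ContDiff ℝ 1 u := hu.of_le (by exact_mod_cast le_top)
        exact this.comp (by fun_prop)
      have hcs : HasCompactSupport (fun r : ℝ => u (z + r • (w : EE N))) := by
        refine hc.comp_isClosedEmbedding (g := fun r : ℝ => z + r • (w : EE N)) ?_
        refine Isometry.isClosedEmbedding ?_
        refine Isometry.of_dist_eq fun a b => ?_
        rw [dist_add_left, dist_eq_norm, ← sub_smul, norm_smul, hw, mul_one, ← dist_eq_norm]
      have := hcs.integral_Ioi_deriv_eq hcd 0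
      simp only [zero_smul, add_zero] at this
      rw [← this]
      refine setIntegral_congr_fun measurableSet_Ioi fun r hr => ?_
      have hr : (0:ℝ) < r := hr
      rw [(hd r).deriv, Set.indicator_of_mem ((hcone r hr _).2 hws), kf, norm_smul, hw, mul_one,
        Real.norm_of_nonneg hr.le, inner_smul_right, inner_smul_right]
      have : r ^ (N - 1) * ((r ^ N)⁻¹ * r) = 1 := by
        rw [show r ^ N = r ^ (N - 1) * r by rw [← pow_succ, hN1]]
        field_simp
      linear_combination (inner ℝ (gradient u (z + r • (w : EE N))) (w : EE N)) * this
    · rw [Set.indicator_of_notMem (by exact hws)]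
      rw [setIntegral_congr_fun (g := fun _ => 0) measurableSet_Ioi, integral_zero]
      intro r hr
      have : r • (w : EE N) ∉ s := fun h => hws ((hcone r hr _).1 h)
      simp [this]
  simp_rw [key]
  rw [integral_indicator_const]
  · simp [mul_comm]
  · exact measurable_subtype_coe hs

lemma kf_norm_rpow {N : ℕ} (hN : 2 ≤ N) (q : ℝ) (v : EE N) :
    ‖kf v‖ ^ q = ‖v‖ ^ (-(((N : ℝ) - 1) * q)) := by
  rw [kf_norm hN, ← Real.rpow_mul (norm_nonneg _), neg_mul]

lemma kf_memLp {N : ℕ} (hN : 2 ≤ N) {q : ℝ} (hq : 1 < q) (hq2 : ((N : ℝ) - 1) * q < N) (L : ℝ) :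
    MemLp ((ball (0 : EE N) L).indicator kf) (ENNReal.ofReal q) volume := by
  have hfin : Module.finrank ℝ (EE N) = N := by simp
  rw [memLp_indicator_iff_restrict measurableSet_ball]
  rw [← integrable_norm_rpow_iff kf_meas.aestronglyMeasurable (by simp; linarith) (by simp)]
  rw [ENNReal.toReal_ofReal (by linarith)]
  simp_rw [kf_norm_rpow hN]
  refine integrableOn_ball_of_norm_le_rpow (C := 1) (α := ((N:ℝ) - 1) * q) (by omega) (by rw [hfin]; linarith) ?_ ?_
  · filter_upwards with x
    rw [one_mul, Real.norm_of_nonneg (by positivity)]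
  · exact (by fun_prop : Measurable fun x : EE N => ‖x‖ ^ (-(((N : ℝ) - 1) * q))).aestronglyMeasurable

lemma transl_tendsto {N : ℕ} {q : ℝ} (hq : 1 < q) (K : EE N → EE N)
    (hK : MemLp K (ENNReal.ofReal q) volume) (x : EE N) :
    Tendsto (fun x' => eLpNorm (fun y => K (y - x') - K (y - x)) (ENNReal.ofReal q) volume)
      (𝓝 x) (𝓝 0) := by
  have : Fact (1 ≤ ENNReal.ofReal q) := ⟨by simpa using hq.le⟩
  let g : EE N → C(EE N, EE N) := fun x => ⟨fun y => y - x, by fun_prop⟩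
  have hgc : Continuous g := by
    let G : C(EE N × EE N, EE N) := ⟨fun a => a.2 - a.1, by fun_prop⟩
    exact G.curry.continuous
  have hgm : ∀ a, MeasurePreserving (g a) (volume : Measure (EE N)) volume :=
    fun a => measurePreserving_sub_right volume a
  have := (Continuous.compMeasurePreservingLp (f := fun _ : EE N => hK.toLp K) continuous_const hgc hgm
    (by simp)).tendsto x
  rw [tendsto_iff_edist_tendsto_0] at this
  refine this.congr fun x' => ?_
  rw [Lp.toLp_compMeasurePreserving hK, Lp.toLp_compMeasurePreserving hK, Lp.edist_toLp_toLp]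
  rfl

lemma kf_memLp_on {N : ℕ} (hN : 2 ≤ N) {q : ℝ} (hq : 1 < q) (hq2 : ((N : ℝ) - 1) * q < N)
    {Ω : Set (EE N)} (hΩb : Bornology.IsBounded Ω) (hΩ : MeasurableSet Ω) (s : Set (EE N))
    (hs : MeasurableSet s) (x : EE N) :
    MemLp (fun y => s.indicator kf (y - x)) (ENNReal.ofReal q) (volume.restrict Ω) := by
  obtain ⟨L, hL⟩ := hΩb.subset_ball x
  have h1 := ((kf_memLp hN hq hq2 L).indicator hs).comp_measurePreserving
    (measurePreserving_sub_right (volume : Measure (EE N)) x)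
  refine (h1.restrict Ω).congr_norm ?_ ?_
  · exact ((kf_meas.indicator hs).comp (measurable_id.sub_const x)).aestronglyMeasurable
  · filter_upwards [ae_restrict_mem hΩ] with y hy
    have : y - x ∈ ball (0 : EE N) L := by
      have := hL hy
      rw [mem_ball, dist_eq_norm] at this ⊢
      simpa using this
    simp only [Function.comp, Set.indicator]
    simp only [this, if_true]

lemma local_tendsto {N : ℕ} (hN : 2 ≤ N) {q : ℝ} (hq : 1 < q) (hq2 : ((N : ℝ) - 1) * q < N)
    {Ω : Set (EE N)} (hΩb : Bornology.IsBounded Ω) (hΩ : MeasurableSet Ω) (x : EE N) :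
    Tendsto (fun x' => eLpNorm (fun y => kf (y - x') - kf (y - x)) (ENNReal.ofReal q)
      (volume.restrict Ω)) (𝓝 x) (𝓝 0) := by
  obtain ⟨L, hL⟩ := hΩb.subset_ball x
  have h := transl_tendsto hq _ (kf_memLp hN hq hq2 (L + 1)) x
  refine tendsto_of_tendsto_of_tendsto_of_le_of_le' tendsto_const_nhds h (by simp) ?_
  filter_upwards [ball_mem_nhds x one_pos] with x' hx'
  refine le_trans (le_of_eq ?_) (eLpNorm_mono_measure _ (Measure.restrict_le_self (s := Ω)))
  refine eLpNorm_congr_ae ?_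
  filter_upwards [ae_restrict_mem hΩ] with y hy
  have h1 := hL hy
  rw [mem_ball, dist_eq_norm] at h1 hx'
  rw [Set.indicator_of_mem, Set.indicator_of_mem]
  · rw [mem_ball, dist_zero_right]; linarith
  · rw [mem_ball, dist_zero_right]
    have := norm_sub_le (y - x) (x' - x)
    rw [sub_sub_sub_cancel_right] at this
    linarith

lemma grad_memLp {N : ℕ} {u : EE N → ℝ} (hu : ContDiff ℝ (⊤ : ℕ∞) u)
    (hc : HasCompactSupport u) (p : ENNReal) (Ω : Set (EE N)) :
    MemLp (gradient u) p (volume.restrict Ω) :=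
  ((grad_cont hu).memLp_of_hasCompactSupport (grad_cs hc)).restrict _

lemma inner_integrable {N : ℕ} {p q : ℝ} (hpq : p.HolderConjugate q) {μ : Measure (EE N)}
    {f g : EE N → EE N}
    (hf : MemLp f (ENNReal.ofReal p) μ) (hg : MemLp g (ENNReal.ofReal q) μ) :
    Integrable (fun y => inner ℝ (f y) (g y)) μ := by
  have : ENNReal.HolderConjugate (ENNReal.ofReal p) (ENNReal.ofReal q) := hpq.ennrealOfReal
  refine (MemLp.integrable_mul hf.norm hg.norm).mono' (hf.1.inner hg.1) ?_
  filter_upwards with y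
  exact norm_inner_le_norm _ _

lemma holder_inner {N : ℕ} {p q : ℝ} (hpq : p.HolderConjugate q) {μ : Measure (EE N)}
    {f g : EE N → EE N}
    (hf : MemLp f (ENNReal.ofReal p) μ) (hg : MemLp g (ENNReal.ofReal q) μ) :
    |∫ y, inner ℝ (f y) (g y) ∂μ| ≤ (∫ y, ‖f y‖ ^ p ∂μ) ^ (1 / p) *
      (eLpNorm g (ENNReal.ofReal q) μ).toReal := by
  have : ENNReal.HolderConjugate (ENNReal.ofReal p) (ENNReal.ofReal q) := hpq.ennrealOfReal
  have h1 : |∫ y, inner ℝ (f y) (g y) ∂μ| ≤ ∫ y, ‖f y‖ * ‖g y‖ ∂μ := by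
    rw [← Real.norm_eq_abs]
    refine norm_integral_le_of_norm_le (MemLp.integrable_mul hf.norm hg.norm) ?_
    filter_upwards with y
    exact norm_inner_le_norm _ _
  refine h1.trans ((integral_mul_norm_le_Lp_mul_Lq hpq hf hg).trans ?_)
  rw [hg.eLpNorm_eq_integral_rpow_norm (by simpa using hpq.symm.pos) (by simp)]
  rw [ENNReal.toReal_ofReal hpq.symm.nonneg, ENNReal.toReal_ofReal (by positivity), one_div q]

lemma rep_on {N : ℕ} (hN : 2 ≤ N) {u : EE N → ℝ} (hu : ContDiff ℝ (⊤ : ℕ∞) u)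
    (hc : HasCompactSupport u) {Ω : Set (EE N)} (hsub : tsupport u ⊆ Ω)
    (z : EE N) (s : Set (EE N)) (hs : MeasurableSet s)
    (hcone : ∀ r : ℝ, 0 < r → ∀ w, r • w ∈ s ↔ w ∈ s) :
    ∫ y in Ω, inner ℝ (gradient u y) (s.indicator kf (y - z)) =
      -u z * (volume : Measure (EE N)).toSphere.real {w | (w : EE N) ∈ s} := by
  rw [← rep_cone hN hu hc z s hs hcone]
  rw [setIntegral_eq_integral_of_forall_compl_eq_zero]
  · rw [← integral_add_left_eq_self _ z]
    simp
  · intro y hy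
    have : gradient u y = 0 := by
      by_contra h
      exact hy (hsub (grad_supp (subset_tsupport _ h)))
    simp [this]

lemma rep_full {N : ℕ} (hN : 2 ≤ N) {u : EE N → ℝ} (hu : ContDiff ℝ (⊤ : ℕ∞) u)
    (hc : HasCompactSupport u) {Ω : Set (EE N)} (hsub : tsupport u ⊆ Ω) (z : EE N) :
    ∫ y in Ω, inner ℝ (gradient u y) (kf (y - z)) =
      -u z * (N * (volume (ball (0 : EE N) 1)).toReal) := by
  have := rep_on hN hu hc hsub z Set.univ MeasurableSet.univ (by simp)
  simp only [Set.indicator_univ] at this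
  rw [this]
  congr 1
  simp only [Set.mem_univ]
  rw [show {w : sphere (0 : EE N) 1 | True} = Set.univ by ext; simp]
  rw [Measure.toSphere_real_apply_univ]
  simp [Measure.real]

/-- Main duality bound. -/
lemma dual_bound {N : ℕ} (hN : 2 ≤ N) {p q : ℝ} (hpq : p.HolderConjugate q)
    (hq2 : ((N : ℝ) - 1) * q < N)
    {Ω : Set (EE N)} (hΩb : Bornology.IsBounded Ω) (hΩ : MeasurableSet Ω) (x : EE N)
    (b : EE N → EE N) (hb : MemLp b (ENNReal.ofReal q) (volume.restrict Ω))
    {u : EE N → ℝ} (hu : ContDiff ℝ (⊤ : ℕ∞) u)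
    (hc : HasCompactSupport u) (hsub : tsupport u ⊆ Ω)
    (hb0 : ∫ y in Ω, inner ℝ (gradient u y) (b y) = 0) :
    N * (volume (ball (0 : EE N) 1)).toReal * |u x| ≤ (∫ y in Ω, ‖gradient u y‖ ^ p) ^ (1 / p) *
      (eLpNorm (fun y => kf (y - x) + b y) (ENNReal.ofReal q) (volume.restrict Ω)).toReal := by
  have hk := kf_memLp_on hN hpq.symm.lt hq2 hΩb hΩ Set.univ MeasurableSet.univ x
  simp only [Set.indicator_univ] at hk
  have hg := grad_memLp hu hc (ENNReal.ofReal p) Ω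
  refine le_trans (le_of_eq ?_) (holder_inner hpq hg (hk.add hb))
  simp only [inner_add_right]
  rw [integral_add (inner_integrable hpq hg hk) (inner_integrable hpq hg hb), hb0,
    rep_full hN hu hc hsub, add_zero, abs_mul, abs_neg, abs_of_nonneg (a := (N:ℝ) * _) (by positivity)]
  ring

lemma ball_int {N : ℕ} (hN : 2 ≤ N) {α : ℝ} (hα : α < N) {R : ℝ} (hR : 0 < R) (x : EE N) :
    ∫ y in ball x R, ‖y - x‖ ^ (-α) =
      N * (volume (ball (0 : EE N) 1)).toReal * (R ^ ((N : ℝ) - α) / (N - α)) := by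
  have hfin : Module.finrank ℝ (EE N) = N := by simp
  have : Nontrivial (EE N) := by
    apply Module.nontrivial_of_finrank_pos (R := ℝ); omega
  have h1 : ∫ y in ball x R, ‖y - x‖ ^ (-α) =
      ∫ y : EE N, (fun r : ℝ => (Set.Iio R).indicator (fun r => r ^ (-α)) r) ‖y‖ := by
    rw [← integral_indicator measurableSet_ball]
    rw [← integral_sub_right_eq_self (fun y : EE N => (fun r : ℝ => (Set.Iio R).indicator (fun r => r ^ (-α)) r) ‖y‖) x]
    simp only [Set.indicator, mem_ball, dist_eq_norm, Set.mem_Iio]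
  rw [h1, integral_fun_norm_addHaar, hfin]
  have h2 : ∫ y in Set.Ioi (0:ℝ), y ^ (N - 1) • (fun r : ℝ => (Set.Iio R).indicator (fun r => r ^ (-α)) r) y
      = ∫ y in (0:ℝ)..R, y ^ ((N : ℝ) - 1 - α) := by
    rw [intervalIntegral.integral_of_le hR.le, integral_Ioc_eq_integral_Ioo,
      ← integral_indicator measurableSet_Ioi, ← integral_indicator measurableSet_Ioo]
    congr 1
    ext y
    by_cases h0 : 0 < y
    · by_cases h3 : y < R
      · simp only [Set.indicator, Set.mem_Ioi, Set.mem_Iio, Set.mem_Ioo, h0, h3, if_true, and_self, smul_eq_mul]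
        rw [← Real.rpow_natCast y (N - 1), ← Real.rpow_add h0, Nat.cast_sub (by omega)]
        congr 1
        push_cast; ring
      · simp [Set.indicator, h0, h3]
    · simp [Set.indicator, h0]
  rw [h2, integral_rpow (by left; linarith)]
  rw [show (N : ℝ) - 1 - α + 1 = N - α by ring, Real.zero_rpow (by linarith)]
  simp [Measure.real, mul_assoc]

lemma bathtub {N : ℕ} (hN : 2 ≤ N) {α : ℝ} (hα0 : 0 < α) {R : ℝ} (hR : 0 < R) (x : EE N)
    {Ω : Set (EE N)} (hΩ : MeasurableSet Ω) (hvol : volume Ω = volume (ball x R))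
    (h1 : IntegrableOn (fun y => ‖y - x‖ ^ (-α)) Ω)
    (h2 : IntegrableOn (fun y => ‖y - x‖ ^ (-α)) (ball x R)) :
    ∫ y in Ω, ‖y - x‖ ^ (-α) ≤ ∫ y in ball x R, ‖y - x‖ ^ (-α) ∧
    (volume (ball x R \ Ω) ≠ 0 →
      ∫ y in Ω, ‖y - x‖ ^ (-α) < ∫ y in ball x R, ‖y - x‖ ^ (-α)) := by
  have hfin : Module.finrank ℝ (EE N) = N := by simp
  have : Nontrivial (EE N) := by
    apply Module.nontrivial_of_finrank_pos (R := ℝ); omega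
  set f : EE N → ℝ := fun y => ‖y - x‖ ^ (-α) with hf
  set B := ball x R
  have hB : MeasurableSet B := measurableSet_ball
  have hBf : volume B ≠ ⊤ := measure_ball_lt_top.ne
  have hΩf : volume Ω ≠ ⊤ := hvol ▸ hBf
  have hdf : volume (B \ Ω) ≠ ⊤ := measure_ne_top_of_subset Set.sdiff_subset hBf
  have hdf2 : volume (Ω \ B) ≠ ⊤ := measure_ne_top_of_subset Set.sdiff_subset hΩf
  have hm : volume (Ω \ B) = volume (B \ Ω) := by
    have e1 := measure_sdiff_add_inter Ω hB (μ := volume)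
    have e2 := measure_sdiff_add_inter B hΩ (μ := volume)
    rw [hvol, ← e2, Set.inter_comm] at e1
    refine (ENNReal.add_left_inj ?_).1 e1
    exact measure_ne_top_of_subset Set.inter_subset_left hBf
  have s1 := integral_inter_add_sdiff hB h1
  have s2 := integral_inter_add_sdiff hΩ h2
  have i1 : IntegrableOn f (Ω \ B) := h1.mono_set Set.sdiff_subset
  have i2 : IntegrableOn f (B \ Ω) := h2.mono_set Set.sdiff_subset
  have l1 : ∫ y in Ω \ B, f y ≤ (volume (B \ Ω)).toReal * R ^ (-α) := by
    have : ∫ y in Ω \ B, f y ≤ ∫ y in Ω \ B, R ^ (-α) := by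
      refine setIntegral_mono_on i1 (integrableOn_const hdf2) (hΩ.diff hB) ?_
      intro y hy
      have : R ≤ ‖y - x‖ := by
        have := hy.2
        simpa [B, dist_eq_norm] using this
      exact Real.rpow_le_rpow_of_nonpos hR this (by linarith)
    rwa [setIntegral_const, smul_eq_mul, Measure.real, hm] at this
  have ic : IntegrableOn (fun _ : EE N => R ^ (-α)) (B \ Ω) := integrableOn_const hdf
  have hpos : ∀ y ∈ (B \ Ω) \ {x}, 0 < f y - R ^ (-α) := by
    intro y hy
    have h3 : ‖y - x‖ < R := by
      have := hy.1.1
      simpa [B, dist_eq_norm] using this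
    have h4 : 0 < ‖y - x‖ := by
      rw [norm_pos_iff, sub_ne_zero]; exact hy.2
    have := Real.rpow_lt_rpow_of_neg h4 h3 (show -α < 0 by linarith)
    simp only [hf]; linarith
  have hne : ∀ᵐ y ∂volume.restrict (B \ Ω), y ≠ x := by
    refine ae_restrict_of_ae ?_
    simp [ae_iff]
  have hnn : 0 ≤ᵐ[volume.restrict (B \ Ω)] fun y => f y - R ^ (-α) := by
    filter_upwards [hne, ae_restrict_mem (hB.diff hΩ)] with y hy hy2
    exact (hpos y ⟨hy2, hy⟩).le
  have l2 : ∫ y in B \ Ω, (f y - R ^ (-α)) = (∫ y in B \ Ω, f y) - (volume (B \ Ω)).toReal * R ^ (-α) := by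
    rw [integral_sub i2 ic, setIntegral_const, smul_eq_mul, Measure.real]
  have hic : ∫ y in Ω ∩ B, f y = ∫ y in B ∩ Ω, f y := by rw [Set.inter_comm]
  constructor
  · have := integral_nonneg_of_ae hnn
    linarith
  · intro hmz
    have : 0 < ∫ y in B \ Ω, (f y - R ^ (-α)) := by
      rw [setIntegral_pos_iff_support_of_nonneg_ae hnn (i2.sub ic)]
      refine lt_of_lt_of_le (pos_iff_ne_zero.2 ?_) (measure_mono (s := (B \ Ω) \ {x}) ?_)
      · rwa [measure_sdiff_null (measure_singleton x)]
      · intro y hy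
        exact ⟨(hpos y hy).ne', hy.1⟩
    linarith

lemma subset_of_null {N : ℕ} {R : ℝ} (hR : 0 < R) (x : EE N)
    {Ω : Set (EE N)} (hΩ : IsOpen Ω) (h : volume (Ω \ ball x R) = 0) : Ω ⊆ ball x R := by
  have h1 : Ω \ closedBall x R = ∅ := by
    refine ((hΩ.sdiff isClosed_closedBall).measure_eq_zero_iff volume).1 ?_
    exact measure_mono_null (Set.sdiff_subset_sdiff_right ball_subset_closedBall) h
  rw [Set.sdiff_eq_empty] at h1
  rw [← interior_closedBall x hR.ne']
  exact interior_maximal h1 hΩ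

lemma vec_ineq {N : ℕ} {q : ℝ} (hq : 1 < q) (hq2 : q ≤ 2) (a b : EE N) (ha : a ≠ 0) :
    ‖a - b‖ ^ q ≤ ‖a‖ ^ q - q * (‖a‖ ^ (q - 2) * inner ℝ a b) + (2 ^ q + q) * ‖b‖ ^ q := by
  have ha' : 0 < ‖a‖ := norm_pos_iff.2 ha
  rcases le_or_gt ‖b‖ ‖a‖ with h | h
  · rcases eq_or_ne b 0 with rfl | hb
    · simp; positivity
    have hb' : 0 < ‖b‖ := norm_pos_iff.2 hb
    have e1 : ‖a - b‖ ^ 2 = ‖a‖ ^ 2 - 2 * inner ℝ a b + ‖b‖ ^ 2 := norm_sub_sq_real a b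
    have e2 : ‖a - b‖ ^ q = ‖a‖ ^ q * (1 + (‖b‖ ^ 2 - 2 * inner ℝ a b) / ‖a‖ ^ 2) ^ (q / 2) := by
      have : 1 + (‖b‖ ^ 2 - 2 * inner ℝ a b) / ‖a‖ ^ 2 = (‖a - b‖ / ‖a‖) ^ (2:ℝ) := by
        rw [Real.rpow_two, div_pow, e1]; field_simp; ring
      rw [this, ← Real.rpow_mul (by positivity), mul_div_cancel₀ _ (by norm_num : (2:ℝ) ≠ 0),
        Real.div_rpow (by positivity) (by positivity)]
      field_simp
    have e3 : (1 + (‖b‖ ^ 2 - 2 * inner ℝ a b) / ‖a‖ ^ 2) ^ (q / 2) ≤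
        1 + (q / 2) * ((‖b‖ ^ 2 - 2 * inner ℝ a b) / ‖a‖ ^ 2) := by
      refine rpow_one_add_le_one_add_mul_self ?_ (by linarith) (by linarith)
      rw [le_div_iff₀ (by positivity)]
      nlinarith [sq_nonneg ‖a - b‖]
    have e4 : ‖a‖ ^ q = ‖a‖ ^ (q - 2) * ‖a‖ ^ 2 := by
      rw [← Real.rpow_two, ← Real.rpow_add ha']; congr 1; ring
    have e5 : ‖b‖ ^ q = ‖b‖ ^ (q - 2) * ‖b‖ ^ 2 := by
      rw [← Real.rpow_two, ← Real.rpow_add hb']; congr 1; ring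
    have e6 : ‖a‖ ^ (q - 2) ≤ ‖b‖ ^ (q - 2) := Real.rpow_le_rpow_of_nonpos hb' h (by linarith)
    have e7 : ‖a‖ ^ (q - 2) * ‖b‖ ^ 2 ≤ ‖b‖ ^ q := by rw [e5]; gcongr
    have e8 : ‖a - b‖ ^ q ≤ ‖a‖ ^ q * (1 + (q / 2) * ((‖b‖ ^ 2 - 2 * inner ℝ a b) / ‖a‖ ^ 2)) := by
      rw [e2]; gcongr
    have e9 : ‖a‖ ^ q * (1 + (q / 2) * ((‖b‖ ^ 2 - 2 * inner ℝ a b) / ‖a‖ ^ 2)) =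
        ‖a‖ ^ q - q * (‖a‖ ^ (q - 2) * inner ℝ a b) + q / 2 * (‖a‖ ^ (q - 2) * ‖b‖ ^ 2) := by
      rw [e4]; field_simp; ring
    rw [e9] at e8
    have e10 : q / 2 * (‖a‖ ^ (q - 2) * ‖b‖ ^ 2) ≤ (2 ^ q + q) * ‖b‖ ^ q := by
      have h2 : (0:ℝ) < 2 ^ q := by positivity
      gcongr
      linarith
    linarith
  · have hb' : 0 < ‖b‖ := ha'.trans h
    have f1 : ‖a - b‖ ^ q ≤ 2 ^ q * ‖b‖ ^ q := by
      rw [← Real.mul_rpow (by norm_num) (by positivity)]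
      refine Real.rpow_le_rpow (by positivity) ?_ (by linarith)
      linarith [norm_sub_le a b]
    have f2 : ‖a‖ ^ (q - 2) * inner ℝ a b ≤ ‖b‖ ^ q := by
      calc ‖a‖ ^ (q - 2) * inner ℝ a b ≤ ‖a‖ ^ (q - 2) * (‖a‖ * ‖b‖) := by
            gcongr; exact real_inner_le_norm a b
        _ = ‖a‖ ^ (q - 1) * ‖b‖ := by
            rw [← mul_assoc]; congr 1
            nth_rewrite 2 [← Real.rpow_one ‖a‖]
            rw [← Real.rpow_add ha']; congr 1; ring
        _ ≤ ‖b‖ ^ (q - 1) * ‖b‖ := by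
            gcongr
        _ = ‖b‖ ^ q := by
            nth_rewrite 2 [← Real.rpow_one ‖b‖]
            rw [← Real.rpow_add hb']; congr 1; ring
    have f3 : 0 ≤ ‖a‖ ^ q := by positivity
    nlinarith

lemma perturb {N : ℕ} {q : ℝ} (hq : 1 < q) (hq2 : q ≤ 2) {μ : Measure (EE N)} {a b : EE N → EE N}
    (ha : MemLp a (ENNReal.ofReal q) μ) (hb : MemLp b (ENNReal.ofReal q) μ)
    (ha0 : ∀ᵐ y ∂μ, a y ≠ 0)
    (hm : 0 < ∫ y, ‖a y‖ ^ (q - 2) * inner ℝ (a y) (b y) ∂μ) :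
    ∃ l : ℝ, ∫ y, ‖a y - l • b y‖ ^ q ∂μ < ∫ y, ‖a y‖ ^ q ∂μ := by
  have hq0 : 0 < q := by linarith
  have hqr : (ENNReal.ofReal q).toReal = q := ENNReal.toReal_ofReal hq0.le
  have pw : ∀ {f : EE N → EE N}, MemLp f (ENNReal.ofReal q) μ → Integrable (fun y => ‖f y‖ ^ q) μ := by
    intro f hf
    have := hf.integrable_norm_rpow (by simpa using hq0) (by simp)
    rwa [hqr] at this
  have hbi := pw hb
  have hai := pw ha
  set m := ∫ y, ‖a y‖ ^ (q - 2) * inner ℝ (a y) (b y) ∂μ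
  have hmi : Integrable (fun y => ‖a y‖ ^ (q - 2) * inner ℝ (a y) (b y)) μ := by
    by_contra h
    rw [show m = 0 from integral_undef h] at hm
    exact lt_irrefl _ hm
  set D := (2 ^ q + q) * ∫ y, ‖b y‖ ^ q ∂μ
  have hev : ∀ᶠ l : ℝ in 𝓝[>] 0, l ^ (q - 1) * D < q * m := by
    have : Tendsto (fun l : ℝ => l ^ (q - 1) * D) (𝓝[>] 0) (𝓝 (0 ^ (q - 1) * D)) := by
      refine Tendsto.mul_const _ ?_
      exact ((Real.continuous_rpow_const (by linarith)).tendsto 0).mono_left nhdsWithin_le_nhds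
    rw [Real.zero_rpow (by linarith), zero_mul] at this
    exact this.eventually_lt_const (by positivity)
  obtain ⟨l, hl, hl0⟩ := (hev.and self_mem_nhdsWithin).exists
  have hl0 : 0 < l := hl0
  refine ⟨l, ?_⟩
  have key : ∫ y, ‖a y - l • b y‖ ^ q ∂μ ≤ ∫ y, (‖a y‖ ^ q - q * l * (‖a y‖ ^ (q - 2) * inner ℝ (a y) (b y)) +
      (2 ^ q + q) * l ^ q * ‖b y‖ ^ q) ∂μ := by
    refine integral_mono_ae (pw (ha.sub (hb.const_smul l))) ((hai.sub (hmi.const_mul _)).add (hbi.const_mul _)) ?_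
    filter_upwards [ha0] with y hy
    have := vec_ineq hq hq2 (a y) (l • b y) hy
    rw [norm_smul, Real.norm_of_nonneg hl0.le, Real.mul_rpow hl0.le (norm_nonneg _), inner_smul_right] at this
    refine this.trans (le_of_eq ?_)
    ring
  have hs1 : Integrable (fun y => ‖a y‖ ^ q - q * l * (‖a y‖ ^ (q - 2) * inner ℝ (a y) (b y))) μ :=
    hai.sub (hmi.const_mul _)
  rw [integral_add hs1 (hbi.const_mul _), integral_sub hai (hmi.const_mul _),
    integral_const_mul, integral_const_mul] at key
  have e : l ^ q = l ^ (q - 1) * l := by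
    nth_rewrite 3 [← Real.rpow_one l]
    rw [← Real.rpow_add hl0]; congr 1; ring
  have : (2 ^ q + q) * l ^ q * (∫ y, ‖b y‖ ^ q ∂μ) < q * l * m := by
    rw [e]
    calc _ = (l ^ (q - 1) * D) * l := by simp only [D]; ring
      _ < q * m * l := by gcongr
      _ = _ := by ring
  linarith

lemma halfspace_pos {N : ℕ} (v z : EE N) {e : ℝ} (he : 0 < e) :
    volume {y | y ∈ ball z e ∧ 0 ≤ inner ℝ v (y - z)} ≠ 0 := by
  intro h
  have hmp := Measure.measurePreserving_sub_left (volume : Measure (EE N)) (z + z)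
  have hms : MeasurableSet {y | y ∈ ball z e ∧ 0 ≤ inner ℝ v (y - z)} := by
    refine measurableSet_ball.inter ?_
    have hcl : IsClosed {y : EE N | 0 ≤ inner ℝ v (y - z)} :=
      isClosed_le continuous_const (by fun_prop)
    exact hcl.measurableSet
  have h2 := hmp.measure_preimage hms.nullMeasurableSet
  rw [h] at h2
  have h3 := measure_union_null h h2
  refine (measure_ball_pos volume z he).ne' (measure_mono_null ?_ h3)
  intro y hy
  rcases le_total 0 (inner ℝ v (y - z)) with h4 | h4
  · left; exact ⟨hy, h4⟩
  · right
    refine ⟨?_, ?_⟩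
    · rw [mem_ball, dist_eq_norm] at hy ⊢
      rw [show z + z - y - z = -(y - z) by abel, norm_neg]; exact hy
    · rw [show z + z - y - z = -(y - z) by abel, inner_neg_right]; linarith

lemma kf_pow_int {N : ℕ} (hN : 2 ≤ N) {q : ℝ} (hq : 1 < q) (hq2 : ((N : ℝ) - 1) * q < N)
    {Ω : Set (EE N)} (hΩb : Bornology.IsBounded Ω) (hΩ : MeasurableSet Ω) (x : EE N) :
    IntegrableOn (fun y => ‖y - x‖ ^ (-(((N : ℝ) - 1) * q))) Ω := by
  have hk := kf_memLp_on hN hq hq2 hΩb hΩ Set.univ MeasurableSet.univ x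
  have := hk.integrable_norm_rpow (by simp; linarith) (by simp)
  rw [ENNReal.toReal_ofReal (by linarith)] at this
  simp only [Set.indicator_univ, kf_norm_rpow hN] at this
  exact this

lemma exists_b {N : ℕ} (hN : 2 ≤ N) {q : ℝ} (hq : 1 < q) (hq2 : ((N : ℝ) - 1) * q < N)
    {Ω : Set (EE N)} (hΩo : IsOpen Ω) (hΩb : Bornology.IsBounded Ω) (x : EE N) {R : ℝ} (hR : 0 < R)
    (hvol : volume Ω = volume (ball x R)) (hne : Ω ≠ ball x R) :
    ∃ b : EE N → EE N, MemLp b (ENNReal.ofReal q) (volume.restrict Ω) ∧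
      (∀ u : EE N → ℝ, ContDiff ℝ (⊤ : ℕ∞) u → HasCompactSupport u → tsupport u ⊆ Ω →
        ∫ y in Ω, inner ℝ (gradient u y) (b y) = 0) ∧
      ∫ y in Ω, ‖kf (y - x) + b y‖ ^ q < ∫ y in ball x R, ‖y - x‖ ^ (-(((N : ℝ) - 1) * q)) := by
  have hN' : (2 : ℝ) ≤ N := by exact_mod_cast hN
  have hfin : Module.finrank ℝ (EE N) = N := by simp
  have : Nontrivial (EE N) := by
    apply Module.nontrivial_of_finrank_pos (R := ℝ); omega
  have hΩ := hΩo.measurableSet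
  obtain ⟨bt1, bt2⟩ := bathtub hN (α := ((N : ℝ) - 1) * q) (by nlinarith) hR x hΩ hvol
    (kf_pow_int hN hq hq2 hΩb hΩ x) (kf_pow_int hN hq hq2 isBounded_ball measurableSet_ball x)
  by_cases hz : volume (ball x R \ Ω) = 0
  swap
  · refine ⟨0, MemLp.zero, by simp, ?_⟩
    simpa [kf_norm_rpow hN] using bt2 hz
  have hz2 : volume (Ω \ ball x R) = 0 := by
    have e1 := measure_sdiff_add_inter Ω (measurableSet_ball (x := x) (ε := R)) (μ := volume)
    have e2 := measure_sdiff_add_inter (ball x R) hΩ (μ := volume)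
    rw [hz, zero_add] at e2
    rw [hvol, ← e2, Set.inter_comm] at e1
    have hf : volume (ball x R ∩ Ω) ≠ ⊤ :=
      measure_ne_top_of_subset Set.inter_subset_left measure_ball_lt_top.ne
    by_contra h
    have := ENNReal.lt_add_right hf h
    rw [add_comm, e1] at this
    exact lt_irrefl _ this
  have hsub := subset_of_null hR x hΩo hz2
  obtain ⟨z, hzB, hzΩ⟩ : ∃ z ∈ ball x R, z ∉ Ω := by
    by_contra! h
    exact hne (hsub.antisymm h)
  set S : Set (EE N) := {w | 0 ≤ inner ℝ (z - x) w} with hS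
  have hSm : MeasurableSet S := (isClosed_le continuous_const (by fun_prop)).measurableSet
  have hScone : ∀ r : ℝ, 0 < r → ∀ w, r • w ∈ S ↔ w ∈ S := by
    intro r hr w
    simp only [hS, Set.mem_ofPred_eq, inner_smul_right]
    exact mul_nonneg_iff_of_pos_left hr
  have ha := kf_memLp_on hN hq hq2 hΩb hΩ Set.univ MeasurableSet.univ x
  simp only [Set.indicator_univ] at ha
  have hb := kf_memLp_on hN hq hq2 hΩb hΩ S hSm z
  have hq22 : q ≤ 2 := by nlinarith
  have hval : ∀ y, y - z ∈ S → y ≠ x → y ≠ z →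
      0 < ‖kf (y - x)‖ ^ (q - 2) * inner ℝ (kf (y - x)) (S.indicator kf (y - z)) := by
    intro y hy hyx hyz
    rw [Set.indicator_of_mem hy]
    have h1 : 0 < ‖y - x‖ := norm_pos_iff.2 (sub_ne_zero.2 hyx)
    have h2 : 0 < ‖y - z‖ := norm_pos_iff.2 (sub_ne_zero.2 hyz)
    have h3 : 0 < inner ℝ (y - x) (y - z) := by
      rw [show y - x = (y - z) + (z - x) by abel, inner_add_left, real_inner_self_eq_norm_sq]
      have : 0 ≤ inner ℝ (z - x) (y - z) := hy
      positivity
    have h4 : 0 < ‖kf (y - x)‖ := by rw [kf_norm hN]; positivity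
    rw [kf, kf, inner_smul_left, inner_smul_right] at *
    simp only [conj_trivial]
    positivity
  have hax : ∀ᵐ y ∂(volume.restrict Ω), y ≠ x := by
    refine ae_restrict_of_ae ?_
    simp [ae_iff]
  have haz : ∀ᵐ y ∂(volume.restrict Ω), y ≠ z := by
    refine ae_restrict_of_ae ?_
    simp [ae_iff]
  have ha0 : ∀ᵐ y ∂(volume.restrict Ω), kf (y - x) ≠ 0 := by
    filter_upwards [hax] with y hy
    rw [← norm_pos_iff, kf_norm hN]
    have : 0 < ‖y - x‖ := norm_pos_iff.2 (sub_ne_zero.2 hy)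
    positivity
  have hai := ha.integrable_norm_rpow (by simp; linarith) (by simp)
  have hbi := hb.integrable_norm_rpow (by simp; linarith) (by simp)
  rw [ENNReal.toReal_ofReal (by linarith)] at hai hbi
  have hmint : IntegrableOn (fun y => ‖kf (y - x)‖ ^ (q - 2) * inner ℝ (kf (y - x)) (S.indicator kf (y - z))) Ω := by
    refine (hai.add hbi).mono' ?_ ?_
    · have m1 : Measurable fun y => kf (y - x) := kf_meas.comp (by fun_prop)
      have m2 : Measurable fun y => S.indicator kf (y - z) := (kf_meas.indicator hSm).comp (by fun_prop)
      exact ((m1.norm.pow_const _).mul (m1.inner m2)).aestronglyMeasurable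
    · filter_upwards [ha0] with y hy
      set a := kf (y - x)
      set b := S.indicator kf (y - z)
      have ha' : 0 < ‖a‖ := norm_pos_iff.2 hy
      have g1 : ‖‖a‖ ^ (q - 2) * inner ℝ a b‖ ≤ ‖a‖ ^ (q - 1) * ‖b‖ := by
        rw [norm_mul, Real.norm_of_nonneg (by positivity)]
        calc _ ≤ ‖a‖ ^ (q - 2) * (‖a‖ * ‖b‖) := by gcongr; exact norm_inner_le_norm _ _
          _ = _ := by
            rw [← mul_assoc]; congr 1
            nth_rewrite 2 [← Real.rpow_one ‖a‖]
            rw [← Real.rpow_add ha']; congr 1; ring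
      refine g1.trans ?_
      simp only [Pi.add_apply]
      have e : ∀ t : ℝ, 0 ≤ t → t ^ q = t ^ (q - 1) * t := by
        intro t ht
        rcases ht.eq_or_lt with rfl | ht
        · rw [mul_zero, Real.zero_rpow (by linarith)]
        · nth_rewrite 3 [← Real.rpow_one t]
          rw [← Real.rpow_add ht]; congr 1; ring
      rcases le_total ‖a‖ ‖b‖ with h | h
      · have : ‖a‖ ^ (q - 1) * ‖b‖ ≤ ‖b‖ ^ q := by
          rw [e ‖b‖ (norm_nonneg _)]; gcongr
        have : 0 ≤ ‖a‖ ^ q := by positivity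
        linarith
      · have : ‖a‖ ^ (q - 1) * ‖b‖ ≤ ‖a‖ ^ q := by
          rw [e ‖a‖ (norm_nonneg _)]; gcongr
        have : 0 ≤ ‖b‖ ^ q := by positivity
        linarith
  have hm : 0 < ∫ y in Ω, ‖kf (y - x)‖ ^ (q - 2) * inner ℝ (kf (y - x)) (S.indicator kf (y - z)) := by
    rw [setIntegral_pos_iff_support_of_nonneg_ae _ hmint]
    · obtain ⟨e, he, hball⟩ := Metric.isOpen_iff.1 isOpen_ball z hzB
      refine pos_iff_ne_zero.2 fun h0 => halfspace_pos (z - x) z he ?_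
      have hn : volume (((ball x R \ Ω) ∪ {x}) ∪ {z}) = 0 :=
        measure_union_null (measure_union_null hz (measure_singleton _)) (measure_singleton _)
      refine measure_mono_null ?_ (measure_union_null h0 hn)
      rintro y ⟨hy1, hy2⟩
      by_cases hyx : y = x
      · right; left; right; exact hyx
      by_cases hyz : y = z
      · right; right; exact hyz
      by_cases hyΩ : y ∈ Ω
      · left
        exact ⟨(hval y hy2 hyx hyz).ne', hyΩ⟩
      · right; left; left
        exact ⟨hball hy1, hyΩ⟩
    · filter_upwards [hax, haz] with y h1 h2
      by_cases hy : y - z ∈ S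
      · exact (hval y hy h1 h2).le
      · simp [hy]
  obtain ⟨l, hl⟩ := perturb hq hq22 ha hb ha0 hm
  refine ⟨fun y => (-l) • S.indicator kf (y - z), hb.const_smul (-l), ?_, ?_⟩
  · intro u hu hc hs
    simp only [inner_smul_right]
    rw [integral_const_mul, rep_on hN hu hc hs z S hSm hScone]
    have : u z = 0 := image_eq_zero_of_notMem_tsupport fun h => hzΩ (hs h)
    rw [this]; simp
  · refine lt_of_lt_of_le (lt_of_eq_of_lt ?_ hl) (le_trans (le_of_eq ?_) bt1)
    · simp only [neg_smul, sub_eq_add_neg]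
    · simp only [kf_norm_rpow hN]

lemma eLp_kf {N : ℕ} {q : ℝ} (hq : 1 < q) {μ : Measure (EE N)} {g : EE N → EE N}
    (hg : MemLp g (ENNReal.ofReal q) μ) :
    eLpNorm g (ENNReal.ofReal q) μ = ENNReal.ofReal ((∫ y, ‖g y‖ ^ q ∂μ) ^ (1 / q)) := by
  rw [hg.eLpNorm_eq_integral_rpow_norm (by simp; linarith) (by simp),
    ENNReal.toReal_ofReal (by linarith), one_div]

noncomputable def FF (N : ℕ) (q R : ℝ) : ℝ := N * (volume (ball (0 : EE N) 1)).toReal *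
    (R ^ ((N : ℝ) - ((N : ℝ) - 1) * q) / (N - ((N : ℝ) - 1) * q))

lemma core_weak {N : ℕ} (hN : 2 ≤ N) {p q : ℝ} (hpq : p.HolderConjugate q)
    (hq2 : ((N : ℝ) - 1) * q < N)
    {Ω : Set (EE N)} (hΩb : Bornology.IsBounded Ω) (hΩ : MeasurableSet Ω) {R : ℝ} (hR : 0 < R)
    (hvol : volume Ω = volume (ball (0 : EE N) R))
    {u : EE N → ℝ} (hu : ContDiff ℝ (⊤ : ℕ∞) u)
    (hc : HasCompactSupport u) (hsub : tsupport u ⊆ Ω) (x : EE N) :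
    N * (volume (ball (0 : EE N) 1)).toReal * |u x| ≤ (∫ y in Ω, ‖gradient u y‖ ^ p) ^ (1 / p) *
      (FF N q R) ^ (1 / q) := by
  have hN' : (2 : ℝ) ≤ N := by exact_mod_cast hN
  have hq := hpq.symm.lt
  refine (dual_bound hN hpq hq2 hΩb hΩ x 0 MemLp.zero hu hc hsub (by simp)).trans ?_
  have ha := kf_memLp_on hN hq hq2 hΩb hΩ Set.univ MeasurableSet.univ x
  simp only [Set.indicator_univ] at ha
  simp only [Pi.zero_apply, add_zero]
  rw [eLp_kf hq ha, ENNReal.toReal_ofReal (by positivity)]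
  have hvx : volume Ω = volume (ball x R) := by
    rw [hvol]; simp [Measure.addHaar_ball_center]
  obtain ⟨bt1, -⟩ := bathtub hN (α := ((N : ℝ) - 1) * q) (by nlinarith) hR x hΩ hvx
    (kf_pow_int hN hq hq2 hΩb hΩ x) (kf_pow_int hN hq hq2 isBounded_ball measurableSet_ball x)
  rw [ball_int hN hq2 hR] at bt1
  gcongr
  simp only [kf_norm_rpow hN]
  exact bt1

lemma core_strict {N : ℕ} (hN : 2 ≤ N) {p q : ℝ} (hpq : p.HolderConjugate q)
    (hq2 : ((N : ℝ) - 1) * q < N)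
    {Ω : Set (EE N)} (hΩb : Bornology.IsBounded Ω) (hΩo : IsOpen Ω) {R : ℝ} (hR : 0 < R)
    (hvol : volume Ω = volume (ball (0 : EE N) R)) (hnb : ∀ x, Ω ≠ ball x R) :
    ∃ C, C < (FF N q R) ^ (1 / q) ∧ ∀ u : EE N → ℝ, ContDiff ℝ (⊤ : ℕ∞) u →
    HasCompactSupport u → tsupport u ⊆ Ω → ∀ x ∈ closure Ω,
    N * (volume (ball (0 : EE N) 1)).toReal * |u x| ≤ (∫ y in Ω, ‖gradient u y‖ ^ p) ^ (1 / p) *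
      C := by
  have hN' : (2 : ℝ) ≤ N := by exact_mod_cast hN
  have hq := hpq.symm.lt
  have hΩ := hΩo.measurableSet
  suffices h : ∃ C, C < (FF N q R) ^ (1 / q) ∧ ∀ x ∈ closure Ω, ∀ u : EE N → ℝ, ContDiff ℝ (⊤ : ℕ∞) u →
    HasCompactSupport u → tsupport u ⊆ Ω → 
    N * (volume (ball (0 : EE N) 1)).toReal * |u x| ≤ (∫ y in Ω, ‖gradient u y‖ ^ p) ^ (1 / p) * C by
    obtain ⟨C, h1, h2⟩ := h
    exact ⟨C, h1, fun u a b c x hx => h2 x hx u a b c⟩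
  refine (hΩb.isCompact_closure).induction_on (p := fun s => ∃ C, C < (FF N q R) ^ (1 / q) ∧ ∀ x ∈ s, ∀ u : EE N → ℝ, ContDiff ℝ (⊤ : ℕ∞) u →
    HasCompactSupport u → tsupport u ⊆ Ω → 
    N * (volume (ball (0 : EE N) 1)).toReal * |u x| ≤ (∫ y in Ω, ‖gradient u y‖ ^ p) ^ (1 / p) * C)
    ?_ ?_ ?_ ?_
  · exact ⟨(FF N q R) ^ (1 / q) - 1, by linarith, by simp⟩
  · rintro s t hst ⟨C, h1, h2⟩
    exact ⟨C, h1, fun x hx => h2 x (hst hx)⟩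
  · rintro s t ⟨C, h1, h2⟩ ⟨D, h3, h4⟩
    refine ⟨max C D, max_lt h1 h3, ?_⟩
    intro x hx u a b c
    have h0 : 0 ≤ (∫ y in Ω, ‖gradient u y‖ ^ p) ^ (1 / p) := by positivity
    rcases hx with hx | hx
    · exact (h2 x hx u a b c).trans (by gcongr; exact le_max_left _ _)
    · exact (h4 x hx u a b c).trans (by gcongr; exact le_max_right _ _)
  · intro x hx
    have hvx : volume Ω = volume (ball x R) := by
      rw [hvol]; simp [Measure.addHaar_ball_center]
    obtain ⟨b, hb1, hb2, hb3⟩ := exists_b hN hq hq2 hΩo hΩb x hR hvx (hnb x)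
    rw [ball_int hN hq2 hR] at hb3
    change _ < FF N q R at hb3
    have hk : ∀ x, MemLp (fun y => kf (y - x)) (ENNReal.ofReal q) (volume.restrict Ω) := by
      intro x
      have ha := kf_memLp_on hN hq hq2 hΩb hΩ Set.univ MeasurableSet.univ x
      simpa only [Set.indicator_univ] using ha
    have hint0 : 0 ≤ ∫ y in Ω, ‖kf (y - x) + b y‖ ^ q := by positivity
    have hlt : (∫ y in Ω, ‖kf (y - x) + b y‖ ^ q) ^ (1 / q) < (FF N q R) ^ (1 / q) :=
      Real.rpow_lt_rpow hint0 hb3 (by have := hpq.symm.pos; positivity)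
    obtain ⟨C, hC1, hC2⟩ := exists_between hlt
    have hC0 : 0 ≤ C := le_trans (by positivity) hC1.le
    refine ⟨_, mem_nhdsWithin_of_mem_nhds ?_, C, hC2, fun x' (hx' : x' ∈ {x' | eLpNorm (fun y => kf (y - x') + b y) (ENNReal.ofReal q) (volume.restrict Ω) ≤ ENNReal.ofReal C}) u hu hc hs => ?_⟩
    · have ht := local_tendsto hN hq hq2 hΩb hΩ x
      have ht2 := ht.const_add (eLpNorm (fun y => kf (y - x) + b y) (ENNReal.ofReal q) (volume.restrict Ω))
      rw [add_zero] at ht2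
      have hlt2 : eLpNorm (fun y => kf (y - x) + b y) (ENNReal.ofReal q) (volume.restrict Ω) < ENNReal.ofReal C := by
        have e0 := eLp_kf hq (g := fun y => kf (y - x) + b y) ((hk x).add hb1)
        rw [e0]
        exact (ENNReal.ofReal_lt_ofReal_iff (lt_of_le_of_lt (by positivity) hC1)).2 hC1
      filter_upwards [ht2.eventually_lt_const hlt2] with x' hx'
      refine le_trans ?_ hx'.le
      have e : (fun y => kf (y - x') + b y) = (fun y => kf (y - x) + b y) + (fun y => kf (y - x') - kf (y - x)) := by
        ext1 y; simp only [Pi.add_apply]; abel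
      rw [e]
      refine eLpNorm_add_le ((hk x).add hb1).1 ((hk x').sub (hk x)).1 ?_
      simpa using hq.le
    · refine (dual_bound hN hpq hq2 hΩb hΩ x' b hb1 hu hc hs (hb2 u hu hc hs)).trans ?_
      have h0 : 0 ≤ (∫ y in Ω, ‖gradient u y‖ ^ p) ^ (1 / p) := by positivity
      gcongr
      exact ENNReal.toReal_le_of_le_ofReal hC0 hx'

lemma step_fn {T d : ℝ} (hd : 0 < d) (hdT : 4 * d < T) :
    ∃ Θ ψ : ℝ → ℝ, ContDiff ℝ (⊤ : ℕ∞) Θ ∧ (∀ t, HasDerivAt Θ (ψ t) t) ∧ (∀ t, 0 ≤ ψ t ∧ ψ t ≤ 1) ∧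
      (∀ t ≤ d, Θ t = 0) ∧ (∀ t, T - d ≤ t → Θ t = Θ T) ∧ (∀ t, 0 ≤ Θ t ∧ Θ t ≤ Θ T) ∧
      T - 4 * d ≤ Θ T := by
  let f : ContDiffBump (T / 2) := ⟨T / 2 - 2 * d, T / 2 - d, by linarith, by linarith⟩
  have hfc : Continuous f := f.continuous
  have hder : ∀ t, HasDerivAt (fun t => ∫ s in (d)..t, f s) (f t) t := fun t =>
    (hfc.integral_hasStrictDerivAt d t).hasDerivAt
  have hf0 : ∀ t, t ≤ d → f t = 0 := by
    intro t ht
    apply f.zero_of_le_dist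
    rw [Real.dist_eq, abs_of_nonpos (by linarith)]
    change T / 2 - d ≤ _
    linarith
  have hf1 : ∀ t, T - d ≤ t → f t = 0 := by
    intro t ht
    apply f.zero_of_le_dist
    rw [Real.dist_eq, abs_of_nonneg (by linarith)]
    change T / 2 - d ≤ _
    linarith
  have hmono : Monotone (fun t => ∫ s in (d)..t, f s) := by
    apply monotone_of_deriv_nonneg (fun t => (hder t).differentiableAt)
    intro t; rw [(hder t).deriv]; exact f.nonneg
  have z0 : ∀ t ≤ d, ∫ s in (d)..t, f s = 0 := by
    intro t ht
    rw [intervalIntegral.integral_congr (g := fun _ => 0)]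
    · simp
    · intro s hs
      rw [Set.uIcc_of_ge ht] at hs
      exact hf0 s hs.2
  have z1 : ∀ t, T - d ≤ t → ∫ s in (d)..t, f s = ∫ s in (d)..T, f s := by
    have : ∀ t, T - d ≤ t → ∫ s in (d)..t, f s = ∫ s in (d)..(T - d), f s := by
      intro t ht
      rw [← sub_eq_zero, intervalIntegral.integral_interval_sub_left (hfc.intervalIntegrable _ _) (hfc.intervalIntegrable _ _)]
      rw [intervalIntegral.integral_congr (g := fun _ => 0)]
      · simp
      · intro s hs
        rw [Set.uIcc_of_le ht] at hs
        exact hf1 s hs.1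
    intro t ht
    rw [this t ht, this T (by linarith)]
  refine ⟨fun t => ∫ s in (d)..t, f s, f, ?_, hder, fun t => ⟨f.nonneg, f.le_one⟩, z0, z1, ?_, ?_⟩
  · rw [contDiff_infty_iff_deriv]
    refine ⟨fun t => (hder t).differentiableAt, ?_⟩
    rw [show deriv (fun t => ∫ s in (d)..t, f s) = f from funext fun t => (hder t).deriv]
    exact f.contDiff
  · intro t
    constructor
    · rcases le_total t d with h | h
      · exact (z0 t h).ge
      · have := hmono h
        simp only at this
        rwa [intervalIntegral.integral_same] at this
    · rcases le_total t T with h | h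
      · exact hmono h
      · exact (z1 t (by linarith)).le
  · have e1 : ∫ s in (2 * d)..(T - 2 * d), f s = T - 4 * d := by
      rw [intervalIntegral.integral_congr (g := fun _ => (1 : ℝ))]
      · simp; ring
      · intro s hs
        rw [Set.uIcc_of_le (by linarith)] at hs
        apply f.one_of_mem_closedBall
        rw [mem_closedBall, Real.dist_eq, abs_le]
        change -(T / 2 - 2 * d) ≤ _ ∧ _ ≤ T / 2 - 2 * d
        constructor <;> linarith [hs.1, hs.2]
    rw [← intervalIntegral.integral_interval_sub_left (a := d) (hfc.intervalIntegrable _ _) (hfc.intervalIntegrable _ _)] at e1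
    have h1 : (0 : ℝ) ≤ ∫ s in (d)..(2 * d), f s := by
      have := hmono (show d ≤ 2 * d by linarith)
      simp only at this
      rwa [intervalIntegral.integral_same] at this
    have h2 : ∫ s in (d)..(T - 2 * d), f s ≤ ∫ s in (d)..T, f s := hmono (by linarith)
    simp only
    linarith

lemma test_fn {N : ℕ} (hN : 2 ≤ N) {p q : ℝ} (hpq : p.HolderConjugate q)
    (hq2 : ((N : ℝ) - 1) * q < N) {R : ℝ} (hR : 0 < R) (x₀ : EE N) {M : ℝ} (hM : 0 < M)
    (hMR : M < R ^ ((N : ℝ) - ((N : ℝ) - 1) * q)) :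
    ∃ u : EE N → ℝ, ContDiff ℝ (⊤ : ℕ∞) u ∧ HasCompactSupport u ∧ tsupport u ⊆ ball x₀ R ∧
      sSup ((fun x => |u x|) '' ball x₀ R) = 1 ∧
      ∫ x in ball x₀ R, ‖gradient u x‖ ^ p ≤ (((N : ℝ) - ((N : ℝ) - 1) * q) / M) ^ p * FF N q R := by
  have hN' : (2 : ℝ) ≤ N := by exact_mod_cast hN
  have hq := hpq.symm.lt
  have hp := hpq.pos
  have : Nontrivial (EE N) := by
    apply Module.nontrivial_of_finrank_pos (R := ℝ); simp; omega
  set β : ℝ := (N : ℝ) - ((N : ℝ) - 1) * q with hβ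
  have hβ0 : 0 < β := by rw [hβ]; linarith
  set T := R ^ β with hT
  obtain ⟨Θ, ψ, hΘs, hΘd, hψ, hΘ0, hΘ1, hΘb, hΘM⟩ := step_fn (T := T) (d := (T - M) / 4)
    (by linarith) (by linarith)
  set d := (T - M) / 4 with hd
  have hd0 : 0 < d := by rw [hd]; linarith
  have hdT : 4 * d < T := by rw [hd]; linarith
  have hK : M ≤ Θ T := by rw [hd] at hΘM; linarith
  set K := Θ T with hKd
  have hK0 : 0 < K := by linarith
  let h : ℝ → ℝ := fun r => Θ (T - r ^ β) / K
  let u : EE N → ℝ := fun x => h ‖x - x₀‖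
  have hu0 : u x₀ = 1 := by
    simp only [u, h, sub_self, norm_zero, Real.zero_rpow hβ0.ne', sub_zero]
    exact div_self hK0.ne'
  have hub : ∀ x, |u x| ≤ 1 := by
    intro x
    have := hΘb (T - ‖x - x₀‖ ^ β)
    rw [abs_of_nonneg (div_nonneg this.1 hK0.le)]
    exact (div_le_one hK0).2 this.2
  have hsm : ContDiff ℝ (⊤ : ℕ∞) u := by
    rw [contDiff_iff_contDiffAt]
    intro x
    by_cases hx : x = x₀
    · subst hx
      have : u =ᶠ[𝓝 x] fun _ => 1 := by
        have hc : ContinuousAt (fun y => ‖y - x‖ ^ β) x := by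
          apply Continuous.continuousAt
          exact Continuous.rpow_const (by fun_prop) (fun _ => Or.inr hβ0.le)
        have : ∀ᶠ y in 𝓝 x, ‖y - x‖ ^ β < d := by
          apply hc.eventually_lt continuousAt_const
          simp [Real.zero_rpow hβ0.ne', hd0]
        filter_upwards [this] with y hy
        simp only [u, h]
        rw [hΘ1 _ (by linarith)]
        exact div_self hK0.ne'
      exact contDiffAt_const.congr_of_eventuallyEq this
    · have hx' : x - x₀ ≠ 0 := sub_ne_zero.2 hx
      have h1 : ContDiffAt ℝ (⊤ : ℕ∞) (fun y => ‖y - x₀‖) x :=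
        (contDiffAt_id.sub contDiffAt_const).norm ℝ hx'
      have h2 := h1.rpow_const_of_ne (p := β) (norm_ne_zero_iff.2 hx')
      exact (hΘs.contDiffAt.comp x (contDiffAt_const.sub h2)).div_const _
  have hgrad : ∀ x, x ≠ x₀ → ‖gradient u x‖ ≤ (β / M) * ‖x - x₀‖ ^ (β - 1) := by
    intro x hx
    have hx' : x - x₀ ≠ 0 := sub_ne_zero.2 hx
    have hn : 0 < ‖x - x₀‖ := norm_pos_iff.2 hx'
    have hnd : DifferentiableAt ℝ (fun v : EE N => ‖v‖) (x - x₀) :=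
      (contDiffAt_norm ℝ hx').differentiableAt (n := 1) (by simp)
    have h1 := hnd.hasFDerivAt.comp x ((hasFDerivAt_id x).sub_const x₀)
    have h2 : HasDerivAt h (ψ (T - ‖x - x₀‖ ^ β) * (-(β * ‖x - x₀‖ ^ (β - 1))) / K) ‖x - x₀‖ := by
      have h3 := (Real.hasDerivAt_rpow_const (p := β) (Or.inl hn.ne')).const_sub T
      exact ((hΘd _).comp _ h3).div_const K
    have h4 := h2.comp_hasFDerivAt x h1
    have h5 : fderiv ℝ u x = _ := h4.fderiv
    rw [gradient, LinearIsometryEquiv.norm_map, h5, norm_smul]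
    have h6 : ‖(fderiv ℝ (fun v : EE N => ‖v‖) (x - x₀)).comp (ContinuousLinearMap.id ℝ (EE N))‖ = 1 := by
      rw [ContinuousLinearMap.comp_id]
      exact norm_fderiv_norm hnd
    rw [h6, mul_one, norm_div, norm_mul, norm_neg, Real.norm_of_nonneg hK0.le,
      Real.norm_of_nonneg (hψ _).1, Real.norm_of_nonneg (by positivity : 0 ≤ β * ‖x - x₀‖ ^ (β - 1))]
    calc _ ≤ 1 * (β * ‖x - x₀‖ ^ (β - 1)) / M := by
          gcongr
          exact (hψ _).2
      _ = _ := by ring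
  have hts : tsupport u ⊆ closedBall x₀ ((T - d) ^ (1 / β)) := by
    apply closure_minimal _ isClosed_closedBall
    intro x hx
    rw [mem_closedBall, dist_eq_norm]
    by_contra! hlt
    apply hx
    have h1 : T - d < ‖x - x₀‖ ^ β := by
      have := Real.rpow_lt_rpow (by have : 0 ≤ T - d := by linarith
                                    positivity) hlt hβ0
      rwa [← Real.rpow_mul (by linarith), one_div_mul_cancel hβ0.ne', Real.rpow_one] at this
    simp only [u, h]
    rw [hΘ0 _ (by linarith), zero_div]
  have hlt : (T - d) ^ (1 / β) < R := by
    have h1 : (T - d) ^ (1 / β) < T ^ (1 / β) := Real.rpow_lt_rpow (by linarith) (by linarith) (by positivity)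
    rwa [hT, ← Real.rpow_mul hR.le, mul_one_div_cancel hβ0.ne', Real.rpow_one] at h1
  refine ⟨u, hsm, ?_, hts.trans (closedBall_subset_ball hlt), ?_, ?_⟩
  · exact (isCompact_closedBall _ _).of_isClosed_subset (isClosed_tsupport _) hts
  · apply IsGreatest.csSup_eq
    refine ⟨⟨x₀, mem_ball_self hR, by simp [hu0]⟩, ?_⟩
    rintro _ ⟨x, -, rfl⟩
    exact hub x
  · have hii := (kf_pow_int hN hq hq2 (isBounded_ball (x := x₀) (r := R)) measurableSet_ball x₀).const_mul ((β / M) ^ p)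
    have : ∫ y in ball x₀ R, (β / M) ^ p * ‖y - x₀‖ ^ (-(((N : ℝ) - 1) * q)) = (β / M) ^ p * FF N q R := by
      rw [integral_const_mul, ball_int hN hq2 hR]; rfl
    rw [← this]
    refine integral_mono_of_nonneg (Eventually.of_forall fun y => by positivity) hii ?_
    have hax : ∀ᵐ y ∂(volume.restrict (ball x₀ R)), y ≠ x₀ := by
      refine ae_restrict_of_ae ?_
      simp [ae_iff]
    filter_upwards [hax] with y hy
    calc ‖gradient u y‖ ^ p ≤ ((β / M) * ‖y - x₀‖ ^ (β - 1)) ^ p := by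
          have := hgrad y hy
          gcongr
      _ = _ := by
          rw [Real.mul_rpow (by positivity) (by positivity), ← Real.rpow_mul (norm_nonneg _)]
          congr 2
          have := hpq.symm.mul_eq_add
          rw [hβ]
          linear_combination (-((N : ℝ) - 1)) * this

lemma value_eq {N : ℕ} (hN : 2 ≤ N) {p q ω R : ℝ} (hpq : p.HolderConjugate q)
    (hω : 0 < ω) (hR : 0 < R) (hpN : (N : ℝ) < p) :
    N * ω ^ (p / N) * ((p - N) / (p - 1)) ^ (p - 1) * (ω * R ^ N) ^ (1 - p / N) =
     N * ω * (((N : ℝ) - ((N : ℝ) - 1) * q) / R ^ ((N : ℝ) - ((N : ℝ) - 1) * q)) ^ (p - 1) := by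
  have hN' : (2 : ℝ) ≤ N := by exact_mod_cast hN
  have hq : q = p / (p - 1) := hpq.conjugate_eq
  have hp1 : 0 < p - 1 := by linarith
  have hβ : (N : ℝ) - ((N : ℝ) - 1) * q = (p - N) / (p - 1) := by
    rw [hq]; field_simp; ring
  rw [hβ]
  have hβ0 : 0 < (p - N) / (p - 1) := div_pos (by linarith) hp1
  rw [Real.div_rpow hβ0.le (by positivity), ← Real.rpow_mul hR.le, div_mul_cancel₀ _ hp1.ne',
    Real.mul_rpow hω.le (by positivity), ← Real.rpow_natCast R N, ← Real.rpow_mul hR.le]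
  have e1 : (N : ℝ) * (1 - p / N) = -(p - N) := by field_simp; ring
  have e2 : ω ^ (p / N) * ω ^ (1 - p / N) = ω := by
    rw [← Real.rpow_add hω]; simp
  rw [e1, Real.rpow_neg hR.le]
  calc _ = N * (ω ^ (p / N) * ω ^ (1 - p / N)) * ((p - N) / (p - 1)) ^ (p - 1) * (R ^ (p - N))⁻¹ := by ring
    _ = _ := by rw [e2]; ring

lemma FF_pow {A T β p q : ℝ} (hpq : p.HolderConjugate q) (hA : 0 < A) (hT : 0 < T) (hβ : 0 < β) :
    A ^ p / ((A * (T / β)) ^ (1 / q)) ^ p = A * (β / T) ^ (p - 1) := by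
  have hq : q = p / (p - 1) := hpq.conjugate_eq
  have hp := hpq.pos
  have hp1 : 0 < p - 1 := hpq.sub_one_pos
  have e : 1 / q * p = p - 1 := by rw [hq]; field_simp
  rw [← Real.rpow_mul (by positivity), e, Real.mul_rpow hA.le (by positivity),
    Real.div_rpow hT.le hβ.le, Real.div_rpow hβ.le hT.le, Real.rpow_sub_one hA.ne']
  have : 0 < A ^ p := by positivity
  have : 0 < T ^ (p - 1) := by positivity
  have : 0 < β ^ (p - 1) := by positivity
  field_simp

lemma gen_bound {A E C s p : ℝ} (hp : 0 < p) (hs : 0 ≤ s) (hA : 0 < A) (hC : 0 < C) (hE : 0 ≤ E)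
    (h : A * s ≤ E ^ (1 / p) * C) : A ^ p / C ^ p * s ^ p ≤ E := by
  have h1 := Real.rpow_le_rpow (by positivity) h hp.le
  rw [Real.mul_rpow hA.le hs, Real.mul_rpow (by positivity) hC.le, ← Real.rpow_mul hE,
    one_div_mul_cancel hp.ne', Real.rpow_one] at h1
  rw [div_mul_eq_mul_div, div_le_iff₀ (by positivity)]
  exact h1

lemma sup_bound {N : ℕ} {Ω : Set (EE N)} (hne : Ω.Nonempty) {u : EE N → ℝ} {A B : ℝ} (hA : 0 < A)
    (h : ∀ x ∈ Ω, A * |u x| ≤ B) : A * sSup ((fun x => |u x|) '' Ω) ≤ B := by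
  rw [← le_div_iff₀' hA]
  apply csSup_le (hne.image _)
  rintro _ ⟨x, hx, rfl⟩
  rw [le_div_iff₀' hA]
  exact h x hx

lemma sup_nonneg' {N : ℕ} {Ω : Set (EE N)} {u : EE N → ℝ} : 0 ≤ sSup ((fun x => |u x|) '' Ω) := by
  apply Real.sSup_nonneg
  rintro _ ⟨x, hx, rfl⟩
  positivity

lemma q_small {N : ℕ} (hN : 2 ≤ N) {p q : ℝ} (hpq : p.HolderConjugate q) (hpN : (N : ℝ) < p) :
    ((N : ℝ) - 1) * q < N := by
  have hN' : (2 : ℝ) ≤ N := by exact_mod_cast hN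
  have hq : q = p / (p - 1) := hpq.conjugate_eq
  have hp1 : 0 < p - 1 := by linarith
  rw [hq, mul_div_assoc', div_lt_iff₀ hp1]
  nlinarith


noncomputable def VV (N : ℕ) (p q R : ℝ) : ℝ :=
  N * (volume (ball (0 : EE N) 1)).toReal *
    (((N : ℝ) - ((N : ℝ) - 1) * q) / R ^ ((N : ℝ) - ((N : ℝ) - 1) * q)) ^ (p - 1)

lemma om_pos (N : ℕ) : 0 < (volume (ball (0 : EE N) 1)).toReal :=
  ENNReal.toReal_pos (measure_ball_pos volume _ one_pos).ne' measure_ball_lt_top.ne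

lemma weak_main {N : ℕ} (hN : 2 ≤ N) {p q : ℝ} (hpq : p.HolderConjugate q) (hpN : (N : ℝ) < p)
    {Ω : Set (EE N)} (hΩb : Bornology.IsBounded Ω) (hΩ : MeasurableSet Ω) (hne : Ω.Nonempty)
    {R : ℝ} (hR : 0 < R) (hvol : volume Ω = volume (ball (0 : EE N) R))
    {u : EE N → ℝ} (hu : ContDiff ℝ (⊤ : ℕ∞) u)
    (hc : HasCompactSupport u) (hsub : tsupport u ⊆ Ω) :
    VV N p q R * sSup ((fun x => |u x|) '' Ω) ^ p ≤ ∫ y in Ω, ‖gradient u y‖ ^ p := by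
  have hN' : (2 : ℝ) ≤ N := by exact_mod_cast hN
  have hq2 := q_small hN hpq hpN
  have hω := om_pos N
  have hA : 0 < N * (volume (ball (0 : EE N) 1)).toReal := by positivity
  have hβ : 0 < (N : ℝ) - ((N : ℝ) - 1) * q := by linarith
  have hF : 0 < FF N q R := by unfold FF; positivity
  have := gen_bound hpq.pos sup_nonneg' hA (by positivity) (by positivity) (sup_bound hne hA fun x _ =>
    core_weak hN hpq hq2 hΩb hΩ hR hvol hu hc hsub x)
  rw [FF, FF_pow hpq hA (by positivity) hβ] at this
  exact this

lemma strict_main {N : ℕ} (hN : 2 ≤ N) {p q : ℝ} (hpq : p.HolderConjugate q) (hpN : (N : ℝ) < p)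
    {Ω : Set (EE N)} (hΩb : Bornology.IsBounded Ω) (hΩ : IsOpen Ω) (hne : Ω.Nonempty)
    {R : ℝ} (hR : 0 < R) (hvol : volume Ω = volume (ball (0 : EE N) R)) (hnb : ∀ x, Ω ≠ ball x R) :
    ∃ C, VV N p q R < C ∧ ∀ u : EE N → ℝ, ContDiff ℝ (⊤ : ℕ∞) u → HasCompactSupport u →
      tsupport u ⊆ Ω →
      C * sSup ((fun x => |u x|) '' Ω) ^ p ≤ ∫ y in Ω, ‖gradient u y‖ ^ p := by
  have hN' : (2 : ℝ) ≤ N := by exact_mod_cast hN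
  have hq2 := q_small hN hpq hpN
  have hω := om_pos N
  have hA : 0 < N * (volume (ball (0 : EE N) 1)).toReal := by positivity
  have hβ : 0 < (N : ℝ) - ((N : ℝ) - 1) * q := by linarith
  have hF : 0 < FF N q R := by unfold FF; positivity
  have hp := hpq.pos
  obtain ⟨C, hC, hb⟩ := core_strict hN hpq hq2 hΩb hΩ hR hvol hnb
  have hG : 0 < FF N q R ^ (1 / q) := by positivity
  set D := max C (FF N q R ^ (1 / q) / 2) with hD
  have hD0 : 0 < D := lt_of_lt_of_le (by linarith) (le_max_right _ _)
  have hD1 : D < FF N q R ^ (1 / q) := max_lt hC (by linarith)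
  refine ⟨(N * (volume (ball (0 : EE N) 1)).toReal) ^ p / D ^ p, ?_, ?_⟩
  · have e := FF_pow hpq hA (show 0 < R ^ ((N : ℝ) - ((N : ℝ) - 1) * q) by positivity) hβ
    unfold VV
    rw [← e]
    change _ / (FF N q R ^ (1 / q)) ^ p < _
    gcongr
  · intro u hu hc hs
    refine gen_bound hpq.pos sup_nonneg' hA hD0 (by positivity) (sup_bound hne hA fun x hx =>
      (hb u hu hc hs x (subset_closure hx)).trans ?_)
    have : 0 ≤ (∫ y in Ω, ‖gradient u y‖ ^ p) ^ (1 / p) := by positivity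
    gcongr
    exact le_max_left _ _

lemma exists_R {N : ℕ} (hN : 2 ≤ N) {Ω : Set (EE N)} (hΩb : Bornology.IsBounded Ω) (hΩ : IsOpen Ω)
    (hne : Ω.Nonempty) : ∃ R : ℝ, 0 < R ∧ volume Ω = volume (ball (0 : EE N) R) := by
  have hω := om_pos N
  have hV : 0 < (volume Ω).toReal :=
    ENNReal.toReal_pos (hΩ.measure_pos volume hne).ne' hΩb.measure_lt_top.ne
  refine ⟨((volume Ω).toReal / (volume (ball (0 : EE N) 1)).toReal) ^ (1 / (N : ℝ)), by positivity, ?_⟩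
  rw [Measure.addHaar_ball_of_pos _ _ (by positivity)]
  have hN0 : (N : ℝ) ≠ 0 := by positivity
  have e : (((volume Ω).toReal / (volume (ball (0 : EE N) 1)).toReal) ^ (1 / (N : ℝ))) ^
      Module.finrank ℝ (EE N) = (volume Ω).toReal / (volume (ball (0 : EE N) 1)).toReal := by
    rw [show Module.finrank ℝ (EE N) = N by simp, ← Real.rpow_natCast, ← Real.rpow_mul (by positivity),
      one_div_mul_cancel hN0, Real.rpow_one]
  rw [e]
  nth_rewrite 2 [← ENNReal.ofReal_toReal (measure_ball_lt_top (μ := volume) (x := (0 : EE N)) (r := 1)).ne]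
  rw [← ENNReal.ofReal_mul (by positivity), div_mul_cancel₀ _ hω.ne', ENNReal.ofReal_toReal hΩb.measure_lt_top.ne]

lemma val_VV {N : ℕ} (hN : 2 ≤ N) {p q : ℝ} (hpq : p.HolderConjugate q) (hpN : (N : ℝ) < p)
    {Ω : Set (EE N)} {R : ℝ} (hR : 0 < R) (hvol : volume Ω = volume (ball (0 : EE N) R)) :
    N * (volume (ball (0 : EE N) 1)).toReal ^ (p / N) *
          ((p - N) / (p - 1)) ^ (p - 1) * (volume Ω).toReal ^ (1 - p / N) = VV N p q R := by
  rw [VV, ← value_eq hN hpq (om_pos N) hR hpN, hvol, Measure.addHaar_ball_of_pos _ _ hR,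
    ENNReal.toReal_mul, ENNReal.toReal_ofReal (by positivity), mul_comm (R ^ _)]
  simp

lemma VV_pos {N : ℕ} (hN : 2 ≤ N) {p q : ℝ} (hpq : p.HolderConjugate q) (hpN : (N : ℝ) < p)
    {R : ℝ} (hR : 0 < R) : 0 < VV N p q R := by
  have hq2 := q_small hN hpq hpN
  have hω := om_pos N
  have hβ : 0 < (N : ℝ) - ((N : ℝ) - 1) * q := by linarith
  unfold VV
  have : (0 : ℝ) < N := by positivity
  positivity

lemma FF_VV {N : ℕ} (hN : 2 ≤ N) {p q : ℝ} (hpq : p.HolderConjugate q) (hpN : (N : ℝ) < p)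
    {R : ℝ} (hR : 0 < R) :
    (((N : ℝ) - ((N : ℝ) - 1) * q) / R ^ ((N : ℝ) - ((N : ℝ) - 1) * q)) ^ p * FF N q R = VV N p q R := by
  have hq2 := q_small hN hpq hpN
  have hβ : 0 < (N : ℝ) - ((N : ℝ) - 1) * q := by linarith
  have hT : 0 < R ^ ((N : ℝ) - ((N : ℝ) - 1) * q) := by positivity
  rw [VV, FF, Real.rpow_sub_one (by positivity)]
  field_simp

theorem stmt7 {N : ℕ} (hN : 2 ≤ N) (Ω : Set (EuclideanSpace ℝ (Fin N)))
    (hΩo : IsOpen Ω) (hΩb : Bornology.IsBounded Ω) (hΩc : IsConnected Ω)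
    (p : ℝ) (hp : (N : ℝ) < p) :
    (LambdaP Ω p =
        N * (volume (ball (0 : EuclideanSpace ℝ (Fin N)) 1)).toReal ^ (p / N) *
          ((p - N) / (p - 1)) ^ (p - 1) * (volume Ω).toReal ^ (1 - p / N) ↔
      ∃ (x₀ : EuclideanSpace ℝ (Fin N)) (r : ℝ), 0 < r ∧ Ω = ball x₀ r) ∧
    ((¬ ∃ (x₀ : EuclideanSpace ℝ (Fin N)) (r : ℝ), 0 < r ∧ Ω = ball x₀ r) →
      ∀ u : EuclideanSpace ℝ (Fin N) → ℝ,
        ContDiff ℝ (⊤ : ℕ∞) u → HasCompactSupport u → tsupport u ⊆ Ω → u ≠ 0 →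
        N * (volume (ball (0 : EuclideanSpace ℝ (Fin N)) 1)).toReal ^ (p / N) *
            ((p - N) / (p - 1)) ^ (p - 1) * (volume Ω).toReal ^ (1 - p / N) *
            (sSup ((fun x => |u x|) '' Ω)) ^ p <
          ∫ x in Ω, ‖gradient u x‖ ^ p) := by
  have hN' : (2 : ℝ) ≤ N := by exact_mod_cast hN
  have hpq : p.HolderConjugate (p / (p - 1)) := Real.HolderConjugate.conjExponent (by linarith)
  have hne := hΩc.nonempty
  obtain ⟨R, hR, hvol⟩ := exists_R hN hΩb hΩo hne
  have hval := val_VV hN hpq hp hR hvol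
  rw [hval]
  have hVp := VV_pos hN hpq hp hR
  have hstr : (¬ ∃ (x₀ : EuclideanSpace ℝ (Fin N)) (r : ℝ), 0 < r ∧ Ω = ball x₀ r) → _ :=
    fun h => strict_main hN hpq hp hΩb hΩo hne hR hvol (fun x hx => h ⟨x, R, hR, hx⟩)
  refine ⟨⟨?_, ?_⟩, ?_⟩
  · intro hL
    by_contra hnb
    obtain ⟨C, hC, hb⟩ := hstr hnb
    rw [LambdaP] at hL
    by_cases hS : { c : ℝ | ∃ u : EuclideanSpace ℝ (Fin N) → ℝ,
        ContDiff ℝ (⊤ : ℕ∞) u ∧ HasCompactSupport u ∧ tsupport u ⊆ Ω ∧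
        sSup ((fun x => |u x|) '' Ω) = 1 ∧
        c = ∫ x in Ω, ‖gradient u x‖ ^ p }.Nonempty
    · have : C ≤ _ := le_csInf hS (by
        rintro c ⟨u, h1, h2, h3, h4, rfl⟩
        have := hb u h1 h2 h3
        rwa [h4, Real.one_rpow, mul_one] at this)
      rw [hL] at this
      linarith
    · rw [Set.not_nonempty_iff_eq_empty] at hS
      rw [hS, Real.sInf_empty] at hL
      linarith
  · rintro ⟨x₀, r, hr, hΩr⟩
    have hvr : volume Ω = volume (ball (0 : EE N) r) := by
      rw [hΩr]; simp [Measure.addHaar_ball_center]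
    have hVr : VV N p (p / (p - 1)) R = VV N p (p / (p - 1)) r := by
      rw [← hval, ← val_VV hN hpq hp hr hvr]
    rw [hVr]
    have hq2 := q_small hN hpq hp
    set β : ℝ := (N : ℝ) - ((N : ℝ) - 1) * (p / (p - 1)) with hβd
    have hβ : 0 < β := by linarith
    have hT : 0 < r ^ β := by positivity
    have htest : ∀ M : ℝ, 0 < M → M < r ^ β → ∃ c ∈ { c : ℝ | ∃ u : EuclideanSpace ℝ (Fin N) → ℝ,
        ContDiff ℝ (⊤ : ℕ∞) u ∧ HasCompactSupport u ∧ tsupport u ⊆ Ω ∧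
        sSup ((fun x => |u x|) '' Ω) = 1 ∧
        c = ∫ x in Ω, ‖gradient u x‖ ^ p }, c ≤ (β / M) ^ p * FF N (p / (p - 1)) r := by
      intro M hM hMr
      obtain ⟨u, h1, h2, h3, h4, h5⟩ := test_fn hN hpq hq2 hr x₀ hM hMr
      rw [← hΩr] at h3 h4 h5
      exact ⟨_, ⟨u, h1, h2, h3, h4, rfl⟩, h5⟩
    apply le_antisymm
    · rw [← FF_VV hN hpq hp hr, ← hβd]
      have hcont : Tendsto (fun M => (β / M) ^ p * FF N (p / (p - 1)) r) (𝓝[<] (r ^ β))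
          (𝓝 ((β / r ^ β) ^ p * FF N (p / (p - 1)) r)) := by
        apply Tendsto.mono_left _ nhdsWithin_le_nhds
        apply ContinuousAt.tendsto
        have h1 : ContinuousAt (fun M : ℝ => β / M) (r ^ β) := continuousAt_const.div continuousAt_id hT.ne'
        exact (h1.rpow_const (Or.inr hpq.pos.le)).mul continuousAt_const
      refine ge_of_tendsto hcont ?_
      filter_upwards [Ioo_mem_nhdsLT hT] with M hM
      obtain ⟨c, hc, hcl⟩ := htest M hM.1 hM.2
      refine le_trans (csInf_le ⟨0, ?_⟩ hc) hcl
      rintro c ⟨u, h1, h2, h3, h4, rfl⟩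
      positivity
    · obtain ⟨c, hc, -⟩ := htest (r ^ β / 2) (by positivity) (by linarith)
      refine le_csInf ⟨c, hc⟩ ?_
      rintro c ⟨u, h1, h2, h3, h4, rfl⟩
      have := weak_main hN hpq hp hΩb hΩo.measurableSet hne hr hvr h1 h2 h3
      rwa [h4, Real.one_rpow, mul_one] at this
  · intro hnb u h1 h2 h3 h4
    obtain ⟨C, hC, hb⟩ := hstr hnb
    have hs : 0 < sSup ((fun x => |u x|) '' Ω) := by
      obtain ⟨x, hx⟩ := Function.ne_iff.1 h4
      have hxΩ : x ∈ Ω := h3 (subset_tsupport u hx)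
      obtain ⟨B, hB⟩ := h2.exists_bound_of_continuous h1.continuous
      refine lt_of_lt_of_le (abs_pos.2 hx) (le_csSup ⟨B, ?_⟩ ⟨x, hxΩ, rfl⟩)
      rintro _ ⟨y, -, rfl⟩
      exact hB y
    refine lt_of_lt_of_le ?_ (hb u h1 h2 h3)
    gcongr
end
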